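/- Let X ⊂ P^4 be an irreducible hypersurface covered by the lines of a family of dimension 2 such that the Fano scheme Σ is generically reduced. Then the dual variety X̌ of X is a hypersurface of the dual projective space P̌^4, i.e. dim X̌ = 3. -/

import Mathlib

open MvPolynomial

noncomputable section

namespace PaperLines

variable (K : Type) [Field K]

/-- Projective `N`-space over `K`, as the projectivization of `K^{N+1}`. -/
abbrev PP (N : ℕ) := Projectivization K (Fin (N + 1) → K)

/-- The zero locus in `ℙ^N` of a (homogeneous) polynomial. -/
def projZeros {N : ℕ} (F : MvPolynomial (Fin (N + 1)) K) : Set (PP K N) :=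
  {x | ∀ v ∈ x.submodule, eval v F = 0}

/-- The projective linear subspace associated to a linear subspace `W ⊆ K^{N+1}`. -/
def projLinear {N : ℕ} (W : Submodule K (Fin (N + 1) → K)) : Set (PP K N) :=
  {x | x.submodule ≤ W}

/-- The Grassmannian of `k`-dimensional linear subspaces of `K^{N+1}`
(`k = 2` gives the lines of `ℙ^N`, `k = 3` the planes). -/
def Grass (k N : ℕ) := {W : Submodule K (Fin (N + 1) → K) // Module.finrank K W = k}

/-- The set of lines contained in the hypersurface `{F = 0} ⊆ ℙ^N`. -/
def fanoSet {N : ℕ} (F : MvPolynomial (Fin (N + 1)) K) : Set (Grass K 2 N) :=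
  {W | projLinear K W.1 ⊆ projZeros K F}

/-- `X = {F = 0}` is covered by lines. -/
def CoveredByLines {N : ℕ} (F : MvPolynomial (Fin (N + 1)) K) : Prop :=
  ∀ x ∈ projZeros K F, ∃ W ∈ fanoSet K F, x ∈ projLinear K W.1

/-- The ideal of polynomials vanishing on a subset of affine space `K^σ`. -/
def affVanishing {σ : Type} (S : Set (σ → K)) : Ideal (MvPolynomial σ K) where
  carrier := {f | ∀ v ∈ S, eval v f = 0}
  add_mem' := by
    intro a b ha hb v hv
    simp only [map_add, ha v hv, hb v hv, add_zero]
  zero_mem' := by intro v hv; simp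
  smul_mem' := by
    intro c a ha v hv
    simp only [smul_eq_mul, map_mul, ha v hv, mul_zero]

/-- The dimension of a subset of affine space `K^σ`, as the Krull dimension of its
coordinate ring (this only depends on the Zariski closure). -/
def affDim {σ : Type} (S : Set (σ → K)) : WithBot ℕ∞ :=
  ringKrullDim (MvPolynomial σ K ⧸ affVanishing K S)

/-- The affine cone over a subset of `ℙ^N`. -/
def projCone {N : ℕ} (S : Set (PP K N)) : Set (Fin (N + 1) → K) :=
  {v | ∃ x ∈ S, v ∈ x.submodule}

/-- A subset of `ℙ^N` has (projective) dimension `d`:  its affine cone has dimension `d+1`. -/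
def HasProjDim {N : ℕ} (S : Set (PP K N)) (d : ℕ) : Prop :=
  affDim K (projCone K S) = ((d + 1 : ℕ) : WithBot ℕ∞)

/-- A subset of `ℙ^N` has (projective) dimension at most `d`. -/
def ProjDimLE {N : ℕ} (S : Set (PP K N)) (d : ℕ) : Prop :=
  affDim K (projCone K S) ≤ ((d + 1 : ℕ) : WithBot ℕ∞)

/-- A subset of `ℙ^N` has (projective) dimension at least `d`. -/
def ProjDimGE {N : ℕ} (S : Set (PP K N)) (d : ℕ) : Prop :=
  ((d + 1 : ℕ) : WithBot ℕ∞) ≤ affDim K (projCone K S)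

/-- A `k`-tuple of vectors (a "frame") all lying in the subspace `W`. -/
def frameMem {k N : ℕ} (p : Fin k × Fin (N + 1) → K) (W : Submodule K (Fin (N + 1) → K)) : Prop :=
  ∀ i : Fin k, (fun j => p (i, j)) ∈ W

/-- The "Stiefel cone" over a family of `k`-planes: all `k`-tuples of vectors lying in some
member of the family.  Over a `d`-dimensional family it has dimension `d + k²`. -/
def frameCone (k N : ℕ) (S : Set (Grass K k N)) : Set (Fin k × Fin (N + 1) → K) :=
  {p | ∃ W ∈ S, frameMem K p W.1}

/-- A family of `k`-planes has dimension `d` (computed via its Stiefel cone). -/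
def HasGrDim {k N : ℕ} (S : Set (Grass K k N)) (d : ℕ) : Prop :=
  affDim K (frameCone K k N S) = ((d + k * k : ℕ) : WithBot ℕ∞)

/-- A family of `k`-planes has dimension at least `d`. -/
def GrDimGE {k N : ℕ} (S : Set (Grass K k N)) (d : ℕ) : Prop :=
  ((d + k * k : ℕ) : WithBot ℕ∞) ≤ affDim K (frameCone K k N S)

/-- Zariski-closed subsets of the Grassmannian: common zero sets of families of polynomials
in frame coordinates (vanishing being required for every frame). -/
def GrClosed {k N : ℕ} (S : Set (Grass K k N)) : Prop :=
  ∃ 𝒢 : Set (MvPolynomial (Fin k × Fin (N + 1)) K),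
    S = {W | ∀ G ∈ 𝒢, ∀ p, frameMem K p W.1 → eval p G = 0}

/-- The Zariski closure of a family of `k`-planes in the Grassmannian. -/
def grClosure {k N : ℕ} (S : Set (Grass K k N)) : Set (Grass K k N) :=
  ⋂₀ {C | GrClosed K C ∧ S ⊆ C}

/-- Irreducibility of a family of `k`-planes. -/
def GrIrred {k N : ℕ} (S : Set (Grass K k N)) : Prop :=
  S.Nonempty ∧ ∀ C₁ C₂, GrClosed K C₁ → GrClosed K C₂ → S ⊆ C₁ ∪ C₂ → S ⊆ C₁ ∨ S ⊆ C₂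

/-- `S` is an irreducible component of `T` (a maximal irreducible subset). -/
def IsGrComponentOf {k N : ℕ} (S T : Set (Grass K k N)) : Prop :=
  S ⊆ T ∧ GrIrred K S ∧ ∀ S', S ⊆ S' → S' ⊆ T → GrIrred K S' → S' = S

/-- A property `P` holds for a general member of the family `S` of `k`-planes:
it holds on a nonempty principal open subset of `S`. -/
def GenerallyOnGr {k N : ℕ} (S : Set (Grass K k N)) (P : Grass K k N → Prop) : Prop :=
  ∃ G : MvPolynomial (Fin k × Fin (N + 1)) K,
    (∃ W ∈ S, ∃ p, frameMem K p W.1 ∧ eval p G ≠ 0) ∧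
    ∀ W ∈ S, (∃ p, frameMem K p W.1 ∧ eval p G ≠ 0) → P W

/-- A property `P` holds for a general pair of members of the families `S`, `T`. -/
def GenerallyOnGr2 {k N : ℕ} (S T : Set (Grass K k N))
    (P : Grass K k N → Grass K k N → Prop) : Prop :=
  ∃ G : MvPolynomial ((Fin k × Fin (N + 1)) ⊕ (Fin k × Fin (N + 1))) K,
    (∃ W ∈ S, ∃ W' ∈ T, ∃ p q, frameMem K p W.1 ∧ frameMem K q W'.1 ∧
      eval (Sum.elim p q) G ≠ 0) ∧
    ∀ W ∈ S, ∀ W' ∈ T, (∃ p q, frameMem K p W.1 ∧ frameMem K q W'.1 ∧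
      eval (Sum.elim p q) G ≠ 0) → P W W'

/-- A property `P` holds for a general point of the subset `S ⊆ ℙ^N`. -/
def GenerallyOn {N : ℕ} (S : Set (PP K N)) (P : PP K N → Prop) : Prop :=
  ∃ G : MvPolynomial (Fin (N + 1)) K,
    (∃ x ∈ S, ∃ v ∈ x.submodule, eval v G ≠ 0) ∧
    ∀ x ∈ S, (∃ v ∈ x.submodule, eval v G ≠ 0) → P x

/-- A property `P` holds for a general hyperplane (given by a nonzero linear form `L`). -/
def GenerallyOnHyp {N : ℕ} (P : (Fin (N + 1) → K) → Prop) : Prop :=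
  ∃ G : MvPolynomial (Fin (N + 1)) K,
    (∃ L : Fin (N + 1) → K, L ≠ 0 ∧ eval L G ≠ 0) ∧
    ∀ L : Fin (N + 1) → K, L ≠ 0 → eval L G ≠ 0 → P L

/-- Through a general point of `X = {F = 0}` there pass exactly `μ` lines of the family `Lf`. -/
def HasMuOn {N : ℕ} (Lf : Set (Grass K 2 N)) (F : MvPolynomial (Fin (N + 1)) K)
    (μ : ℕ) : Prop :=
  GenerallyOn K (projZeros K F) (fun x => {W | W ∈ Lf ∧ x ∈ projLinear K W.1}.ncard = μ)

/-- Through a general point of `X = {F = 0}` there pass exactly `μ` lines contained in `X`. -/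
def HasMu {N : ℕ} (F : MvPolynomial (Fin (N + 1)) K) (μ : ℕ) : Prop :=
  HasMuOn K (fanoSet K F) F μ

/-- The ideal of the Fano scheme of lines on `{F = 0}`, in Stiefel (frame) coordinates:
it is generated by the coefficients (in `s,t`) of `F(s·v + t·w)`. -/
def fanoIdeal {N : ℕ} (F : MvPolynomial (Fin (N + 1)) K) :
    Ideal (MvPolynomial (Fin 2 × Fin (N + 1)) K) :=
  Ideal.span {g | ∃ d : Fin 2 →₀ ℕ, g = coeff d
    (aeval (fun j : Fin (N + 1) =>
      (X 0 : MvPolynomial (Fin 2) (MvPolynomial (Fin 2 × Fin (N + 1)) K)) * C (X (0, j)) +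
        X 1 * C (X (1, j))) F)}

/-- An ideal is generically reduced: at every minimal prime `p` over `I`, the localization
of `R/I` is reduced, i.e. `I_p = p_p`. -/
def GenericallyReducedIdeal {R : Type} [CommRing R] (I : Ideal R) : Prop :=
  ∀ p ∈ I.minimalPrimes, ∀ x ∈ p, ∃ s, s ∉ p ∧ s * x ∈ I

/-- The Fano scheme of lines on `{F = 0}` is generically reduced. -/
def FanoGenerallyReduced {N : ℕ} (F : MvPolynomial (Fin (N + 1)) K) : Prop :=
  GenericallyReducedIdeal (fanoIdeal K F)

/-- The prime (in frame coordinates) corresponding to a point `r` of the Grassmannian of lines. -/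
def framePrime {N : ℕ} (r : Grass K 2 N) : Ideal (MvPolynomial (Fin 2 × Fin (N + 1)) K) :=
  affVanishing K (frameCone K 2 N {r})

/-- The Fano scheme of lines on `{F = 0}` is reduced at the line `r`. -/
def FanoReducedAt {N : ℕ} (F : MvPolynomial (Fin (N + 1)) K) (r : Grass K 2 N) : Prop :=
  ∀ x ∈ framePrime K r, ∃ s, s ∉ framePrime K r ∧ s * x ∈ fanoIdeal K F

/-- The Fano scheme is reduced at the generic point of the component `Fam`. -/
def ComponentGenerallyReduced {N : ℕ} (F : MvPolynomial (Fin (N + 1)) K)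
    (Fam : Set (Grass K 2 N)) : Prop :=
  ∀ x ∈ affVanishing K (frameCone K 2 N Fam),
    ∃ s, s ∉ affVanishing K (frameCone K 2 N Fam) ∧ s * x ∈ fanoIdeal K F

/-- The gradient vector of `F` at `v`. -/
def gradVec {N : ℕ} (F : MvPolynomial (Fin (N + 1)) K) (v : Fin (N + 1) → K) :
    Fin (N + 1) → K :=
  fun i => eval v (pderiv i F)

/-- The singular locus of the hypersurface `{F = 0}`. -/
def singLocus {N : ℕ} (F : MvPolynomial (Fin (N + 1)) K) : Set (PP K N) :=
  {x | x ∈ projZeros K F ∧ ∀ v ∈ x.submodule, gradVec K F v = 0}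

/-- `x` is a smooth point of the hypersurface `{F = 0}`. -/
def SmoothAt {N : ℕ} (F : MvPolynomial (Fin (N + 1)) K) (x : PP K N) : Prop :=
  x ∈ projZeros K F ∧ x ∉ singLocus K F

/-- The embedded tangent hyperplane to `{F = 0}` at a (smooth) point `x`. -/
def tangentHyp {N : ℕ} (F : MvPolynomial (Fin (N + 1)) K) (x : PP K N) : Set (PP K N) :=
  {y | ∀ v ∈ x.submodule, ∀ w ∈ y.submodule, ∑ i, gradVec K F v i * w i = 0}

/-- The hyperplane of `ℙ^N` with coefficient vector `L`. -/
def hypSet {N : ℕ} (L : Fin (N + 1) → K) : Set (PP K N) :=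
  {x | ∀ v ∈ x.submodule, ∑ i, L i * v i = 0}

/-- A quadric surface in `ℙ⁴`: a two-dimensional intersection of a quadric and a hyperplane. -/
def IsQuadricSurface (Q : Set (PP K 4)) : Prop :=
  ∃ (q : MvPolynomial (Fin 5) K) (W : Submodule K (Fin 5 → K)),
    q.IsHomogeneous 2 ∧ Module.finrank K W = 4 ∧
    Q = projZeros K q ∩ projLinear K W ∧ HasProjDim K Q 2

/-- `X = {F = 0}` is (birationally) ruled by quadrics over a curve: it is covered by a
one-dimensional family of quadric surfaces with exactly one member through a general point. -/
def QuadricBundle (F : MvPolynomial (Fin 5) K) : Prop :=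
  ∃ 𝒬 : Set (Set (PP K 4)),
    (∀ Q ∈ 𝒬, IsQuadricSurface K Q ∧ Q ⊆ projZeros K F) ∧
    GenerallyOn K (projZeros K F) (fun x => ∃! Q, Q ∈ 𝒬 ∧ x ∈ Q)

/-- The degree of a `d`-dimensional subset `S ⊆ ℙ^N`: the largest finite number of points in
which a linear subspace of complementary dimension meets `S`. -/
def projDegree {N : ℕ} (S : Set (PP K N)) (d : ℕ) : ℕ :=
  sSup {m | ∃ W : Submodule K (Fin (N + 1) → K), Module.finrank K W = N + 1 - d ∧
    (S ∩ projLinear K W).Finite ∧ (S ∩ projLinear K W).ncard = m}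

/-- Zariski-closed subsets of `ℙ^N`. -/
def ProjClosed {N : ℕ} (S : Set (PP K N)) : Prop :=
  ∃ 𝒮 : Set (MvPolynomial (Fin (N + 1)) K),
    S = {x | ∀ f ∈ 𝒮, ∀ v ∈ x.submodule, eval v f = 0}

/-- The Zariski closure of a subset of `ℙ^N`. -/
def projClosure {N : ℕ} (S : Set (PP K N)) : Set (PP K N) :=
  ⋂₀ {C | ProjClosed K C ∧ S ⊆ C}

/-- The image of a subset of `ℙ^a` under the rational map `ℙ^a ⤏ ℙ^b` induced by a
linear map `T : K^{a+1} → K^{b+1}`. -/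
def projImage {a b : ℕ} (T : (Fin (a + 1) → K) →ₗ[K] (Fin (b + 1) → K))
    (Y : Set (PP K a)) : Set (PP K b) :=
  {x | ∃ y ∈ Y, ∃ v ∈ y.submodule, ∃ h : T v ≠ 0, x = Projectivization.mk K (T v) h}

/-- `Xs ⊆ ℙ^b` is a (linear) projection of `Y ⊆ ℙ^a`. -/
def IsProjectionOf {a b : ℕ} (Xs : Set (PP K b)) (Y : Set (PP K a)) : Prop :=
  ∃ T : (Fin (a + 1) → K) →ₗ[K] (Fin (b + 1) → K),
    Xs = projClosure K (projImage K T Y)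

/-- `Y ⊆ ℙ⁵` is a three-dimensional complete intersection of two quadric hypersurfaces. -/
def IsQuadricIntersection5 (Y : Set (PP K 5)) : Prop :=
  ∃ q₁ q₂ : MvPolynomial (Fin 6) K, q₁.IsHomogeneous 2 ∧ q₂.IsHomogeneous 2 ∧
    Y = projZeros K q₁ ∩ projZeros K q₂ ∧ HasProjDim K Y 3

def idx55 : Fin 25 ≃ Fin 5 × Fin 5 :=
  (finCongr (by norm_num : 25 = 5 * 5)).trans finProdFinEquiv.symm

/-- The Plücker coordinate vector of the pair `(v, w)`. -/
def pluckOf (v w : Fin 5 → K) : Fin 25 → K :=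
  fun kk => v (idx55 kk).1 * w (idx55 kk).2 - v (idx55 kk).2 * w (idx55 kk).1

/-- The Grassmannian `G(1,4)` of lines of `ℙ⁴` in its Plücker embedding. -/
def grassPlucker : Set (PP K 24) :=
  {x | ∃ v w : Fin 5 → K, ∃ h : pluckOf K v w ≠ 0,
    x = Projectivization.mk K (pluckOf K v w) h}

/-- `Y` is a section of the Plücker-embedded `G(1,4)` by a linear `ℙ⁶`. -/
def IsGrassP6Section (Y : Set (PP K 24)) : Prop :=
  ∃ W : Submodule K (Fin 25 → K), Module.finrank K W = 7 ∧
    Y = grassPlucker K ∩ projLinear K W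

def idx33 : Fin 9 ≃ Fin 3 × Fin 3 :=
  (finCongr (by norm_num : 9 = 3 * 3)).trans finProdFinEquiv.symm

def segre22Vec (a b : Fin 3 → K) : Fin 9 → K := fun kk => a (idx33 kk).1 * b (idx33 kk).2

/-- The Segre embedding of `ℙ² × ℙ²` in `ℙ⁸`. -/
def segreP2P2 : Set (PP K 8) :=
  {x | ∃ a b : Fin 3 → K, ∃ h : segre22Vec K a b ≠ 0,
    x = Projectivization.mk K (segre22Vec K a b) h}

def idx222 : Fin 8 ≃ Fin 2 × Fin 2 × Fin 2 :=
  (finCongr (by norm_num : 8 = 2 * 4)).trans (finProdFinEquiv.symm.trans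
    (Equiv.prodCongr (Equiv.refl _)
      ((finCongr (by norm_num : 4 = 2 * 2)).trans finProdFinEquiv.symm)))

def segre111Vec (a b c : Fin 2 → K) : Fin 8 → K :=
  fun kk => a (idx222 kk).1 * b (idx222 kk).2.1 * c (idx222 kk).2.2

/-- The Segre embedding of `ℙ¹ × ℙ¹ × ℙ¹` in `ℙ⁷`. -/
def segreP1P1P1 : Set (PP K 7) :=
  {x | ∃ a b c : Fin 2 → K, ∃ h : segre111Vec K a b c ≠ 0,
    x = Projectivization.mk K (segre111Vec K a b c) h}

def evalVec {m l : ℕ} (f : Fin l → MvPolynomial (Fin m) K) (v : Fin m → K) : Fin l → K :=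
  fun j => eval v (f j)

/-- Two projective sets are birational: there are rational maps, given by homogeneous
polynomials, defined and mutually inverse on general points. -/
def AreBirational {a b : ℕ} (C : Set (PP K a)) (D : Set (PP K b)) : Prop :=
  ∃ (f : Fin (b + 1) → MvPolynomial (Fin (a + 1)) K)
    (g : Fin (a + 1) → MvPolynomial (Fin (b + 1)) K) (d e : ℕ),
    (∀ j, (f j).IsHomogeneous d) ∧ (∀ i, (g i).IsHomogeneous e) ∧
    GenerallyOn K C (fun x => ∃ v ∈ x.submodule, ∃ h : evalVec K f v ≠ 0,
      Projectivization.mk K (evalVec K f v) h ∈ D ∧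
      ∃ h2 : evalVec K g (evalVec K f v) ≠ 0,
        Projectivization.mk K (evalVec K g (evalVec K f v)) h2 = x) ∧
    GenerallyOn K D (fun y => ∃ w ∈ y.submodule, ∃ h : evalVec K g w ≠ 0,
      Projectivization.mk K (evalVec K g w) h ∈ C ∧
      ∃ h2 : evalVec K f (evalVec K g w) ≠ 0,
        Projectivization.mk K (evalVec K f (evalVec K g w)) h2 = y)

/-- A smooth plane cubic curve (its equation). -/
def IsSmoothPlaneCubic (q : MvPolynomial (Fin 3) K) : Prop :=
  q.IsHomogeneous 3 ∧
    ∀ v : Fin 3 → K, v ≠ 0 → eval v q = 0 → (fun i => eval v (pderiv i q)) ≠ 0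

/-- The hypersurface `{F = 0} ⊆ ℙ⁴` has sectional genus one: its general plane section is a
curve birational to a smooth plane cubic (i.e. of geometric genus `1`). -/
def SectionalGenusOne (F : MvPolynomial (Fin 5) K) : Prop :=
  GenerallyOnGr K (Set.univ : Set (Grass K 3 4)) (fun P =>
    ∃ q : MvPolynomial (Fin 3) K, IsSmoothPlaneCubic K q ∧
      AreBirational K (projZeros K F ∩ projLinear K P.1) (projZeros (N := 2) K q))

/-- The length of a module, as the Krull dimension of its lattice of submodules. -/
def moduleLength (R M : Type) [CommRing R] [AddCommGroup M] [Module R M] : WithBot ℕ∞ :=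
  Order.krullDim (Submodule R M)

/-- The length of the localization of `R/I` at (the complement of) `p`:  when `p` is a prime
containing `I` this is the intersection multiplicity of the scheme `V(I)` at `p`. -/
def localLength {R : Type} [CommRing R] (I p : Ideal R) : WithBot ℕ∞ :=
  moduleLength (Localization (Submonoid.closure {s : R | s ∉ p}))
    (LocalizedModule (Submonoid.closure {s : R | s ∉ p}) (R ⧸ I))

/-- The frame-coordinate ideal of the Schubert variety of lines contained in the hyperplane
with coefficient vector `L`. -/
def hypFrameIdeal (L : Fin 5 → K) : Ideal (MvPolynomial (Fin 2 × Fin 5) K) :=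
  Ideal.span {∑ j, C (L j) * X ((0 : Fin 2), j), ∑ j, C (L j) * X ((1 : Fin 2), j)}

/-- The restriction of a polynomial to the line spanned by `v` and `w`, as a binary form in
the parameters. -/
def restrictLine {N : ℕ} (v w : Fin (N + 1) → K) (G : MvPolynomial (Fin (N + 1)) K) :
    MvPolynomial (Fin 2) K :=
  aeval (fun j => C (v j) * X 0 + C (w j) * X 1) G

/-- The homogeneous polynomials vanishing on a subset `S ⊆ ℙ^N`. -/
def homVanishing {N : ℕ} (S : Set (PP K N)) : Set (MvPolynomial (Fin (N + 1)) K) :=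
  {f | ∀ x ∈ S, ∀ v ∈ x.submodule, eval v f = 0}

/-- The embedded (projectivized) tangent space to the subset `S ⊆ ℙ^N` at the point `P`. -/
def projTangentAt {N : ℕ} (S : Set (PP K N)) (P : PP K N) : Set (PP K N) :=
  {y | ∀ f ∈ homVanishing K S, ∀ v ∈ P.submodule, ∀ w ∈ y.submodule,
    ∑ i, eval v (pderiv i f) * w i = 0}

/-- `P` is a smooth point of the surface `S`: its embedded tangent space is a plane. -/
def IsSmoothSurfacePoint {N : ℕ} (S : Set (PP K N)) (P : PP K N) : Prop :=
  P ∈ S ∧ ∃ W : Submodule K (Fin (N + 1) → K), Module.finrank K W = 3 ∧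
    projTangentAt K S P = projLinear K W

/-- The line `L` is tangent to the surface `S` at the smooth point `P`. -/
def IsTangentLineAt {N : ℕ} (S : Set (PP K N)) (L : Grass K 2 N) (P : PP K N) : Prop :=
  IsSmoothSurfacePoint K S P ∧ P ∈ projLinear K L.1 ∧
    projLinear K L.1 ⊆ projTangentAt K S P

/-- The surface `σ(r)`: the union of the lines of the Fano family meeting the line `r`. -/
def sigmaSurf (F : MvPolynomial (Fin 5) K) (r : Grass K 2 4) : Set (PP K 4) :=
  {x | ∃ W ∈ fanoSet K F, (projLinear K W.1 ∩ projLinear K r.1).Nonempty ∧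
    x ∈ projLinear K W.1}

/-- Substitution of a linear endomorphism into a polynomial: `linSubst φ P = P ∘ φ`. -/
def linSubst {m : ℕ} (φ : (Fin m → K) →ₗ[K] (Fin m → K)) (P : MvPolynomial (Fin m) K) :
    MvPolynomial (Fin m) K :=
  aeval (fun i => ∑ j, C (φ (Pi.single j 1) i) * X j) P

/-- Dehomogenization with respect to the coordinate `x₀`. -/
def dehomAt0 {m : ℕ} (P : MvPolynomial (Fin (m + 1)) K) : MvPolynomial (Fin m) K :=
  aeval (fun i : Fin (m + 1) => Fin.cases 1 (fun j => X j) i) P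

/-- The Gauss image (dual variety, up to closure) of the hypersurface `{F = 0} ⊆ ℙ^N`. -/
def dualVariety {N : ℕ} (F : MvPolynomial (Fin (N + 1)) K) : Set (PP K N) :=
  {h | ∃ x, SmoothAt K F x ∧ ∃ v ∈ x.submodule, ∃ hnz : gradVec K F v ≠ 0,
    h = Projectivization.mk K (gradVec K F v) hnz}

open Algebra in
/-- Krull dimension is invariant under injective integral extensions. -/
theorem ringKrullDim_eq_of_isIntegral (R S : Type*) [CommRing R] [CommRing S] [Algebra R S]
    [Algebra.IsIntegral R S] (hinj : Function.Injective (algebraMap R S)) :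
    ringKrullDim R = ringKrullDim S := by
  apply le_antisymm
  · refine iSup_le fun l => ?_
    obtain ⟨Q, -, hQ, hQl⟩ := Ideal.exists_ideal_over_prime_of_isIntegral (S := S) l.head.asIdeal ⊥
      (by rw [Ideal.comap_bot_of_injective _ hinj]; exact bot_le)
    have : Q.LiesOver (RelSeries.head l).asIdeal := ⟨hQl.symm⟩
    obtain ⟨L, hL, -⟩ := Ideal.exists_ltSeries_of_hasGoingUp l Q
    rw [← hL]
    exact Order.LTSeries.length_le_krullDim L
  · exact Order.krullDim_le_of_strictMono (PrimeSpectrum.comap (algebraMap R S))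
      fun p q hpq => Ideal.IsIntegral.comap_lt_comap hpq

/-- The Krull dimension of a finitely generated domain over a field is its transcendence degree. -/
theorem exists_ringKrullDim_eq_and_trdeg_eq (K A : Type) [Field K] [CommRing A] [IsDomain A]
    [Algebra K A] [Algebra.FiniteType K A] :
    ∃ n : ℕ, ringKrullDim A = n ∧ Algebra.trdeg K A = n := by
  obtain ⟨s, g, hg, hgi⟩ := exists_integral_inj_algHom_of_fg K A
  let := g.toRingHom.toAlgebra
  have : IsScalarTower K (MvPolynomial (Fin s) K) A := .of_algebraMap_eq fun x => (g.commutes x).symm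
  have hinj : Function.Injective (algebraMap (MvPolynomial (Fin s) K) A) := hg
  have : Algebra.IsIntegral (MvPolynomial (Fin s) K) A := ⟨hgi⟩
  have : FaithfulSMul (MvPolynomial (Fin s) K) A := (faithfulSMul_iff_algebraMap_injective _ _).2 hinj
  refine ⟨s, ?_, ?_⟩
  · rw [← ringKrullDim_eq_of_isIntegral _ A hinj]
    simp
  · rw [← trdeg_add_eq K (MvPolynomial (Fin s) K), MvPolynomial.trdeg_of_isDomain,
      trdeg_eq_zero]
    simp

section generated

variable {K L : Type} [Field K] [Field L] [Algebra K L] {σ : Type} (φ : MvPolynomial σ K →ₐ[K] L)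

theorem isFractionRing_range (h : IntermediateField.adjoin K (Set.range fun i => φ (X i)) = ⊤) :
    IsFractionRing φ.range L := by
  refine .of_field _ _ fun z => ?_
  have hz : z ∈ IntermediateField.adjoin K (Set.range fun i => φ (X i)) := h ▸ trivial
  obtain ⟨x, hx, y, hy, e⟩ := IntermediateField.mem_adjoin_iff_div.1 hz
  have key : Algebra.adjoin K (Set.range fun i => φ (X i)) ≤ φ.range :=
    Algebra.adjoin_le (by rintro _ ⟨i, rfl⟩; exact ⟨X i, rfl⟩)
  exact ⟨⟨x, key hx⟩, ⟨y, key hy⟩, e⟩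

theorem exists_ringKrullDim_quotient_ker_eq [Finite σ]
    (h : IntermediateField.adjoin K (Set.range fun i => φ (X i)) = ⊤) :
    ∃ n : ℕ, ringKrullDim (MvPolynomial σ K ⧸ RingHom.ker φ) = n ∧ Algebra.trdeg K L = n := by
  have := isFractionRing_range φ h
  have : Algebra.FiniteType K φ.range := .of_surjective φ.rangeRestrict φ.rangeRestrict_surjective
  obtain ⟨n, h1, h2⟩ := exists_ringKrullDim_eq_and_trdeg_eq K φ.range
  refine ⟨n, ?_, ?_⟩
  · rw [← h1]
    exact ringKrullDim_eq_of_ringEquiv (Ideal.quotientKerEquivRange φ).toRingEquiv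
  · have : Algebra.IsAlgebraic φ.range L := IsLocalization.isAlgebraic _ (nonZeroDivisors φ.range)
    rw [← h2, ← trdeg_add_eq K φ.range, trdeg_eq_zero (R := φ.range) (A := L),
      add_zero]

end generated

/-- In characteristic zero, the dimension of the Kähler differentials of a field extension is its
transcendence degree. -/
theorem rank_kaehlerDifferential_eq_trdeg (K L : Type) [Field K] [CharZero K] [Field L]
    [Algebra K L] : Module.rank L Ω[L⁄K] = Algebra.trdeg K L := by
  obtain ⟨s, hs⟩ := exists_isTranscendenceBasis K L
  let f : MvPolynomial s K →ₐ[K] L := aeval (fun i : s => (i : L))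
  let := f.toRingHom.toAlgebra
  have : IsScalarTower K (MvPolynomial s K) L := .of_algebraMap_eq fun x => (f.commutes x).symm
  have hinj : Function.Injective (algebraMap (MvPolynomial s K) L) := hs.1
  have : FaithfulSMul (MvPolynomial s K) L := (faithfulSMul_iff_algebraMap_injective _ _).2 hinj
  have halg : Algebra.IsAlgebraic (MvPolynomial s K) L := by
    have h1 := hs.isAlgebraic
    let e : MvPolynomial s K ≃ₐ[K] Algebra.adjoin K (Set.range fun i : s => (i : L)) := hs.1.aevalEquiv
    refine .of_ringHom_of_comp_eq e.toRingEquiv (RingHom.id L) e.surjective Function.injective_id ?_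
    refine RingHom.ext fun p => ?_
    exact hs.1.algebraMap_aevalEquiv p
  let E := FractionRing (MvPolynomial s K)
  let : Algebra E L := FractionRing.liftAlgebra _ _
  have : IsScalarTower (MvPolynomial s K) E L := FractionRing.isScalarTower_liftAlgebra _ _
  have : Algebra.IsAlgebraic E L :=
    (IsFractionRing.comap_isAlgebraic_iff (A := MvPolynomial s K)).1 halg
  have : CharZero E := charZero_of_injective_algebraMap (algebraMap K E).injective
  have : Algebra.FormallyEtale E L := .of_isSeparable _ _
  have : Algebra.FormallyEtale (MvPolynomial s K) E := .of_isLocalization (nonZeroDivisors _)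
  have : Algebra.FormallyEtale (MvPolynomial s K) L := .comp _ E _
  let e := KaehlerDifferential.tensorKaehlerEquivOfFormallyEtale K (MvPolynomial s K) L
  let b := ((KaehlerDifferential.mvPolynomialBasis K s).baseChange L).map e
  rw [← b.mk_eq_rank'', hs.cardinalMk_eq_trdeg]

section derivations

variable {K L : Type} [Field K] [Field L] [Algebra K L]

open KaehlerDifferential in
/-- A linear form on Kähler differentials is determined by its values on the differentials of
field generators. -/
theorem kaehlerDifferential_hom_eq_zero {S : Set L} (hS : IntermediateField.adjoin K S = ⊤)
    (δ : Ω[L⁄K] →ₗ[L] L) (h : ∀ s ∈ S, δ (D K L s) = 0) : δ = 0 := by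
  have key : ∀ x, δ (D K L x) = 0 := by
    intro x
    have hx : x ∈ IntermediateField.adjoin K S := hS ▸ trivial
    induction hx using IntermediateField.adjoin_induction with
    | mem x hx => exact h x hx
    | algebraMap x => simp
    | add x y _ _ hx hy => simp [hx, hy]
    | inv x _ hx => simp [Derivation.leibniz_inv, hx]
    | mul x y _ _ hx hy => simp [hx, hy]
  refine LinearMap.ext_on (span_range_derivation K L) ?_
  rintro _ ⟨x, rfl⟩
  simpa using key x

open KaehlerDifferential TensorProduct in
/-- Tangent vectors satisfying equations which define a prime generically extend to derivations of
its residue field. -/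
theorem exists_kaehlerDifferential_hom {σ : Type} [Fintype σ] (φ : MvPolynomial σ K →ₐ[K] L)
    (hφ : IntermediateField.adjoin K (Set.range fun i => φ (X i)) = ⊤)
    {I : Ideal (MvPolynomial σ K)}
    (hI : ∀ x, φ x = 0 → ∃ s, φ s ≠ 0 ∧ s * x ∈ I)
    (a : σ → L) (ha : ∀ g ∈ I, ∑ i, a i * φ (pderiv i g) = 0) :
    ∃ δ : Ω[L⁄K] →ₗ[L] L, ∀ i, δ (D K L (φ (X i))) = a i := by
  classical
  let d : MvPolynomial σ K →ₗ[K] L := ∑ i, a i • (φ.toLinearMap ∘ₗ (pderiv i).toLinearMap)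
  have hd : ∀ g, d g = ∑ i, a i * φ (pderiv i g) := fun g => by simp [d]
  have hmul : ∀ p q, d (p * q) = φ p * d q + φ q * d p := by
    intro p q
    simp only [hd, Derivation.leibniz, smul_eq_mul, map_add, map_mul, Finset.mul_sum,
      ← Finset.sum_add_distrib]
    exact Finset.sum_congr rfl fun i _ => by ring
  have hker : ∀ x, φ x = 0 → d x = 0 := by
    intro x hx
    obtain ⟨s, hs, hsx⟩ := hI x hx
    have h1 := ha _ hsx
    rw [← hd, hmul, hx, zero_mul, add_zero] at h1
    exact (mul_eq_zero.1 h1).resolve_left hs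
  have hwell : ∀ p q, φ p = φ q → d p = d q := fun p q h => by
    rw [← sub_eq_zero, ← map_sub]; exact hker _ (by rw [map_sub, h, sub_self])
  have hsurj : Function.Surjective φ.rangeRestrict := φ.rangeRestrict_surjective
  let u := Function.surjInv hsurj
  have hu : ∀ x, φ (u x) = x := fun x => congrArg Subtype.val (Function.surjInv_eq hsurj x)
  let ℓ : φ.range →ₗ[K] L :=
    { toFun := fun x => d (u x)
      map_add' := fun x y => by
        rw [← map_add]; exact hwell _ _ (by rw [map_add, hu, hu, hu]; rfl)
      map_smul' := fun c x => by
        rw [← map_smul]; exact hwell _ _ (by rw [map_smul, hu, hu]; rfl) }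
  let d' : Derivation K φ.range L := Derivation.mk' ℓ fun x y => by
    change d (u (x * y)) = (x : L) * d (u y) + (y : L) * d (u x)
    rw [← hu x, ← hu y, ← hmul]
    exact hwell _ _ (by rw [map_mul, hu, hu, hu]; rfl)
  have hd' : ∀ p, d' (φ.rangeRestrict p) = d p := fun p => hwell _ _ (by rw [hu]; rfl)
  have := isFractionRing_range φ hφ
  have : Algebra.FormallyEtale φ.range L := .of_isLocalization (nonZeroDivisors φ.range)
  let e := tensorKaehlerEquivOfFormallyEtale K φ.range L
  refine ⟨d'.liftKaehlerDifferential.liftBaseChange L ∘ₗ e.symm.toLinearMap, fun i => ?_⟩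
  have h1 : e.symm (D K L (φ (X i))) = 1 ⊗ₜ D K φ.range (φ.rangeRestrict (X i)) :=
    tensorKaehlerEquivOfFormallyEtale_symm_D_algebraMap K φ.range L (φ.rangeRestrict (X i))
  simp only [LinearMap.comp_apply, LinearEquiv.coe_coe, h1, LinearMap.liftBaseChange_tmul, one_smul,
    Derivation.liftKaehlerDifferential_comp_D, hd', hd]
  simp [pderiv_X, Pi.single_apply]

/-- The dimension of a space of solutions of linearized equations which define a prime generically
is at most the transcendence degree of the residue field. -/
theorem finrank_le_of_trdeg_eq [CharZero K] {σ : Type} [Fintype σ] (φ : MvPolynomial σ K →ₐ[K] L)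
    (hφ : IntermediateField.adjoin K (Set.range fun i => φ (X i)) = ⊤)
    {I : Ideal (MvPolynomial σ K)}
    (hI : ∀ x, φ x = 0 → ∃ s, φ s ≠ 0 ∧ s * x ∈ I)
    (V : Submodule L (σ → L)) (hV : ∀ a ∈ V, ∀ g ∈ I, ∑ i, a i * φ (pderiv i g) = 0)
    {n : ℕ} (hn : Algebra.trdeg K L = n) : Module.finrank L V ≤ n := by
  have hr : Module.rank L Ω[L⁄K] = n := by rw [rank_kaehlerDifferential_eq_trdeg, hn]
  have : Module.Finite L Ω[L⁄K] := Module.rank_lt_aleph0_iff.1 (by rw [hr]; exact Cardinal.natCast_lt_aleph0)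
  let Θ : Module.Dual L Ω[L⁄K] →ₗ[L] (σ → L) :=
    LinearMap.pi fun i => Module.Dual.eval L _ (KaehlerDifferential.D K L (φ (X i)))
  have hle : V ≤ LinearMap.range Θ := fun a ha => by
    obtain ⟨δ, hδ⟩ := exists_kaehlerDifferential_hom φ hφ hI a (hV a ha)
    exact ⟨δ, funext hδ⟩
  calc Module.finrank L V ≤ Module.finrank L (LinearMap.range Θ) := Submodule.finrank_mono hle
    _ ≤ Module.finrank L (Module.Dual L Ω[L⁄K]) := LinearMap.finrank_range_le Θ
    _ = n := by rw [Subspace.dual_finrank_eq]; exact Module.finrank_eq_of_rank_eq hr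

end derivations

section tower

variable {K M Q : Type} [Field K] [Field M] [Field Q] [Algebra K M] [Algebra K Q] [Algebra M Q]
  [IsScalarTower K M Q]

open KaehlerDifferential TensorProduct in
/-- In characteristic zero, linear relations between differentials of elements of a subfield
are preserved by linear forms on the Kähler differentials of the subfield. -/
theorem sum_mul_hom_eq_zero [CharZero K] [Algebra.EssFiniteType M Q] {ι : Type} [Fintype ι]
    (h : ι → M) (x : ι → Q) (h1 : ∑ i, x i • D K Q (algebraMap M Q (h i)) = 0)
    (δ : Ω[M⁄K] →ₗ[M] M) : ∑ i, x i * algebraMap M Q (δ (D K M (h i))) = 0 := by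
  have : CharZero M := charZero_of_injective_algebraMap (algebraMap K M).injective
  have : Algebra.FormallySmooth M Q := .of_perfectField
  have hinj : Function.Injective (mapBaseChange K M Q) := by
    rw [injective_iff_map_eq_zero]
    intro y hy
    obtain ⟨z, rfl⟩ := (Algebra.H1Cotangent.exact_δ_mapBaseChange K M Q y).1 hy
    rw [Subsingleton.elim z 0, map_zero]
  have h2 : ∑ i, x i ⊗ₜ[M] D K M (h i) = 0 := by
    apply hinj
    simp only [map_sum, mapBaseChange_tmul, map_D, map_zero]
    exact h1
  have h3 := congrArg ((Algebra.linearMap M Q ∘ₗ δ).liftBaseChange Q) h2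
  simpa [map_sum] using h3

/-- The rank estimate for the fibres of the Gauss map. -/
theorem finrank_span_add_trdeg_add_one_le [CharZero K] [Algebra.EssFiniteType M Q] {ι : Type}
    [Fintype ι] (h : ι → M) (j : ι) (hj : h j = 1)
    (hadj : IntermediateField.adjoin K (Set.range h) = ⊤) (x : ι → Q)
    (h0 : ∑ i, x i * algebraMap M Q (h i) = 0)
    (h1 : ∑ i, x i • KaehlerDifferential.D K Q (algebraMap M Q (h i)) = 0)
    {m : ℕ} (hm : Algebra.trdeg K M = m) :
    Module.finrank M (Submodule.span M (Set.range x)) + m + 1 ≤ Fintype.card ι := by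
  have hr : Module.rank M Ω[M⁄K] = m := by rw [rank_kaehlerDifferential_eq_trdeg, hm]
  have : Module.Finite M Ω[M⁄K] :=
    Module.rank_lt_aleph0_iff.1 (by rw [hr]; exact Cardinal.natCast_lt_aleph0)
  let Λ : (ι → M) →ₗ[M] Q := Fintype.linearCombination M x
  let Ψ : (M × Module.Dual M Ω[M⁄K]) →ₗ[M] (ι → M) := LinearMap.pi fun i =>
    (LinearMap.toSpanSingleton M M (h i)).coprod
      (Module.Dual.eval M _ (KaehlerDifferential.D K M (h i)))
  have hΨ : ∀ a δ i, Ψ (a, δ) i = a * h i + δ (KaehlerDifferential.D K M (h i)) := by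
    intro a δ i; simp [Ψ]
  have hinj : Function.Injective Ψ := by
    rw [← LinearMap.ker_eq_bot, LinearMap.ker_eq_bot']
    rintro ⟨a, δ⟩ hδ
    have ha : a = 0 := by
      have := congrFun hδ j
      rw [hΨ, hj] at this
      simpa using this
    subst ha
    have : δ = 0 := kaehlerDifferential_hom_eq_zero hadj δ <| by
      rintro _ ⟨i, rfl⟩
      have := congrFun hδ i
      rw [hΨ] at this
      simpa using this
    rw [this]; rfl
  have hle : LinearMap.range Ψ ≤ LinearMap.ker Λ := by
    rintro _ ⟨⟨a, δ⟩, rfl⟩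
    have h2 := sum_mul_hom_eq_zero h x h1 δ
    rw [LinearMap.mem_ker, Fintype.linearCombination_apply]
    have : ∀ i, Ψ (a, δ) i • x i = algebraMap M Q a * (x i * algebraMap M Q (h i)) +
        x i * algebraMap M Q (δ (KaehlerDifferential.D K M (h i))) := by
      intro i
      rw [hΨ, Algebra.smul_def, map_add, map_mul]
      ring
    simp only [this, Finset.sum_add_distrib, ← Finset.mul_sum, h0, h2, mul_zero, add_zero]
  have e1 : m + 1 ≤ Module.finrank M (LinearMap.ker Λ) := by
    calc m + 1 = Module.finrank M (M × Module.Dual M Ω[M⁄K]) := by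
          rw [Module.finrank_prod, Subspace.dual_finrank_eq, Module.finrank_self,
            Module.finrank_eq_of_rank_eq hr, add_comm]
      _ = Module.finrank M (LinearMap.range Ψ) := (LinearMap.finrank_range_of_inj hinj).symm
      _ ≤ _ := Submodule.finrank_mono hle
  have e2 := LinearMap.finrank_range_add_finrank_ker Λ
  rw [Fintype.range_linearCombination, Module.finrank_fintype_fun_eq_card] at e2
  omega

/-- A finite family of vectors can be expressed through a subfamily which is a basis of its
span. -/
theorem exists_subfamily_basis {ι : Type} [Fintype ι] (x : ι → Q) :
    ∃ (r : ℕ) (k : Fin r → ι) (e : ι → Fin r → M),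
      r = Module.finrank M (Submodule.span M (Set.range x)) ∧
      (∀ i, x i = ∑ l, e i l • x (k l)) ∧ ∀ l, e (k l) = Pi.single l 1 := by
  classical
  have : Module.Finite M (Submodule.span M (Set.range x)) := .span_of_finite M (Set.finite_range x)
  obtain ⟨f, hf, hspan, hind⟩ := Submodule.exists_fun_fin_finrank_span_eq M (Set.range x)
  choose k hk using hf
  have hx : ∀ i, x i ∈ Submodule.span M (Set.range f) := fun i => by
    rw [hspan]; exact Submodule.subset_span ⟨i, rfl⟩
  refine ⟨_, k, fun i => hind.repr ⟨x i, hx i⟩, rfl, fun i => ?_, fun l => ?_⟩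
  · have := hind.linearCombination_repr ⟨x i, hx i⟩
    rw [Finsupp.linearCombination_apply, Finsupp.sum_fintype _ _ (by simp)] at this
    simpa [hk] using this.symm
  · funext l'
    beta_reduce
    rw [hind.repr_eq_single l ⟨x (k l), hx (k l)⟩ (by simp [hk]), Finsupp.single_apply,
      Pi.single_apply]
    simp [eq_comm]

/-- A generating family whose length is at most the relative transcendence degree is
algebraically independent. -/
theorem algebraicIndependent_of_adjoin_eq_top {r : ℕ} (y : Fin r → Q)
    (hy : IntermediateField.adjoin M (Set.range y) = ⊤) {m d : ℕ}
    (hm : Algebra.trdeg K M = m) (hd : Algebra.trdeg K Q = d) (hle : m + r ≤ d) :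
    m + r = d ∧ AlgebraicIndependent M y := by
  have h1 : Algebra.trdeg K M + Algebra.trdeg M Q = Algebra.trdeg K Q := trdeg_add_eq K M
  have halg : Algebra.IsAlgebraic (Algebra.adjoin M (Set.range y)) Q := by
    have hfrac : IsFractionRing (Algebra.adjoin M (Set.range y)) Q := by
      refine .of_field _ _ fun z => ?_
      have hz : z ∈ IntermediateField.adjoin M (Set.range y) := hy ▸ trivial
      obtain ⟨a, ha, b, hb, e⟩ := IntermediateField.mem_adjoin_iff_div.1 hz
      exact ⟨⟨a, ha⟩, ⟨b, hb⟩, e⟩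
    exact IsLocalization.isAlgebraic _ (nonZeroDivisors (Algebra.adjoin M (Set.range y)))
  have h2 : Algebra.trdeg M Q ≤ r := by
    refine (Algebra.IsAlgebraic.trdeg_le_cardinalMk M (Set.range y)).trans ?_
    simpa using Cardinal.mk_range_le (f := y)
  obtain ⟨t, ht⟩ := Cardinal.lt_aleph0.1 (h2.trans_lt Cardinal.natCast_lt_aleph0)
  rw [hm, hd, ht] at h1
  rw [ht] at h2
  norm_cast at h1 h2
  have htr : t = r := by omega
  refine ⟨by omega, (Algebra.IsAlgebraic.isTranscendenceBasis_of_le_trdeg_of_finite M y ?_).1⟩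
  rw [ht, htr]; simp

end tower

section hypersurface

variable {K : Type} [Field K]

/-- In characteristic zero, some partial derivative of an irreducible form is not divisible by
it. -/
theorem exists_not_dvd_pderiv [CharZero K] {σ : Type} [Fintype σ] {n : ℕ} {F : MvPolynomial σ K}
    (hdeg : F.IsHomogeneous n) (hIrr : Irreducible F) : ∃ j, ¬ F ∣ pderiv j F := by
  by_contra! hcon
  have hF0 := hIrr.ne_zero
  have hn : n ≠ 0 := by
    rintro rfl
    obtain ⟨c, hc⟩ : ∃ c, F = C c := ⟨_, totalDegree_eq_zero_iff_eq_C.1 (hdeg.totalDegree hF0)⟩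
    refine hIrr.not_isUnit ?_
    rw [hc] at hF0 ⊢
    exact (isUnit_iff_ne_zero.2 fun h => hF0 (by rw [h, map_zero])).map C
  have hz : ∀ j, pderiv j F = 0 := by
    intro j
    by_contra hne
    have h1 := totalDegree_le_of_dvd_of_isDomain (hcon j) hne
    rw [hdeg.totalDegree hF0, hdeg.pderiv.totalDegree hne] at h1
    omega
  have := hdeg.sum_X_mul_pderiv
  simp only [hz, mul_zero, Finset.sum_const_zero, nsmul_eq_mul] at this
  rcases mul_eq_zero.1 this.symm with h | h
  · exact hn (by exact_mod_cast h)
  · exact hF0 h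

theorem D_eq_sum_pderiv {Q σ : Type} [Fintype σ] [Field Q] [Algebra K Q]
    (Φ : MvPolynomial σ K →ₐ[K] Q) (p : MvPolynomial σ K) :
    KaehlerDifferential.D K Q (Φ p) =
      ∑ i, Φ (pderiv i p) • KaehlerDifferential.D K Q (Φ (X i)) := by
  classical
  induction p using MvPolynomial.induction_on with
  | C a => simp [← algebraMap_eq]
  | add p q hp hq => simp [hp, hq, add_smul, Finset.sum_add_distrib]
  | mul_X p i hp =>
    have (j : σ) : Φ (pderiv j (p * X i)) =
        (if j = i then Φ p else 0) + Φ (X i) * Φ (pderiv j p) := by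
      by_cases hji : i = j <;> simp [pderiv_X, hji, eq_comm]
    simp only [this, map_mul, Derivation.leibniz (KaehlerDifferential.D K Q), hp, add_smul,
      Finset.sum_add_distrib, mul_smul, Finset.smul_sum, ite_smul, zero_smul]
    simp

/-- The function field of the affine cone over an irreducible hypersurface. -/
theorem exists_functionField {σ : Type} {F : MvPolynomial σ K} (hIrr : Irreducible F) :
    ∃ (Q : Type) (_ : Field Q) (_ : Algebra K Q) (Φ : MvPolynomial σ K →ₐ[K] Q),
      (∀ p, Φ p = 0 ↔ F ∣ p) ∧
      IntermediateField.adjoin K (Set.range fun i => Φ (X i)) = ⊤ := by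
  have hprime : (Ideal.span {F}).IsPrime :=
    (Ideal.span_singleton_prime hIrr.ne_zero).2 hIrr.prime
  let A := MvPolynomial σ K ⧸ Ideal.span {F}
  let Q := FractionRing A
  let Φ : MvPolynomial σ K →ₐ[K] Q :=
    (IsScalarTower.toAlgHom K A Q).comp (Ideal.Quotient.mkₐ K _)
  refine ⟨Q, inferInstance, inferInstance, Φ, fun p => ?_, ?_⟩
  · rw [← Ideal.mem_span_singleton, ← Ideal.Quotient.eq_zero_iff_mem]
    exact map_eq_zero_iff (algebraMap A Q) (IsFractionRing.injective A Q)
  · rw [eq_top_iff]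
    rintro z -
    have hmem : ∀ p, Φ p ∈ IntermediateField.adjoin K (Set.range fun i => Φ (X i)) := by
      intro p
      induction p using MvPolynomial.induction_on with
      | C a => rw [← algebraMap_eq, AlgHom.commutes]; exact IntermediateField.algebraMap_mem _ a
      | add p q hp hq => rw [map_add]; exact add_mem hp hq
      | mul_X p i hp =>
        rw [map_mul]
        exact mul_mem hp (IntermediateField.subset_adjoin _ _ ⟨i, rfl⟩)
    obtain ⟨a, b, -, rfl⟩ := IsFractionRing.div_surjective (A := A) z
    obtain ⟨a, rfl⟩ := Ideal.Quotient.mk_surjective a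
    obtain ⟨b, rfl⟩ := Ideal.Quotient.mk_surjective b
    exact div_mem (hmem a) (hmem b)

section

variable {Q : Type} [Field Q] [Algebra K Q]

/-- The function field of the affine cone over a hypersurface has the expected transcendence
degree. -/
theorem exists_trdeg_functionField [CharZero K] {N : ℕ} {F : MvPolynomial (Fin (N + 1)) K}
    (Φ : MvPolynomial (Fin (N + 1)) K →ₐ[K] Q) (hΦ : ∀ p, Φ p = 0 ↔ F ∣ p)
    (hQtop : IntermediateField.adjoin K (Set.range fun i => Φ (X i)) = ⊤) :
    ∃ d : ℕ, Algebra.trdeg K Q = d ∧ N ≤ d := by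
  obtain ⟨d, -, hd⟩ := exists_ringKrullDim_quotient_ker_eq Φ hQtop
  refine ⟨d, hd, ?_⟩
  let lin : (Fin (N + 1) → Q) →ₗ[Q] Q := Fintype.linearCombination Q fun i => Φ (pderiv i F)
  have hlin : ∀ a, lin a = ∑ i, a i * Φ (pderiv i F) := fun a => by
    simp [lin, Fintype.linearCombination_apply]
  have h1 : Module.finrank Q (LinearMap.ker lin) ≤ d := by
    refine finrank_le_of_trdeg_eq Φ hQtop (I := Ideal.span {F}) (fun p hp => ⟨1, by simp, ?_⟩) _
      (fun a ha g hg => ?_) hd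
    · rw [one_mul, Ideal.mem_span_singleton]; exact (hΦ p).1 hp
    · obtain ⟨q, rfl⟩ := Ideal.mem_span_singleton.1 hg
      have hF : Φ F = 0 := (hΦ F).2 dvd_rfl
      have : ∀ i, a i * Φ (pderiv i (F * q)) = Φ q * (a i * Φ (pderiv i F)) := fun i => by
        simp only [Derivation.leibniz, smul_eq_mul, map_add, map_mul, hF]; ring
      rw [LinearMap.mem_ker, hlin] at ha
      rw [Finset.sum_congr rfl fun i _ => this i, ← Finset.mul_sum, ha, mul_zero]
  have h2 := LinearMap.finrank_range_add_finrank_ker lin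
  have h3 := (LinearMap.range lin).finrank_le
  rw [Module.finrank_fintype_fun_eq_card, Fintype.card_fin] at h2
  rw [Module.finrank_self] at h3
  omega

theorem exists_subfield_of_family {ι : Type} (h : ι → Q) :
    ∃ (M : Type) (_ : Field M) (_ : Algebra K M) (_ : Algebra M Q) (_ : IsScalarTower K M Q)
      (h' : ι → M), (∀ i, algebraMap M Q (h' i) = h i) ∧
      IntermediateField.adjoin K (Set.range h') = ⊤ := by
  let M := IntermediateField.adjoin K (Set.range h)
  let h' : ι → M := fun i => ⟨h i, IntermediateField.subset_adjoin _ _ ⟨i, rfl⟩⟩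
  refine ⟨M, inferInstance, inferInstance, inferInstance, inferInstance, h', fun i => rfl, ?_⟩
  apply IntermediateField.map_injective M.val
  rw [IntermediateField.adjoin_map, ← Set.range_comp, ← AlgHom.fieldRange_eq_map,
    IntermediateField.fieldRange_val]
  rfl

end

/-- The linear form with coefficient vector `c`. -/
def linForm {M : Type} [Field M] {r : ℕ} (c : Fin r → M) : MvPolynomial (Fin r) M :=
  ∑ l, C (c l) * X l

/-- The structure of the Gauss map of a hypersurface: after adjoining the tangent hyperplane at a
generic point, the generic point becomes the generic point of a linear space, along which the
tangent hyperplane is constant. -/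
theorem exists_gauss_fibration [CharZero K] {N n : ℕ} {F : MvPolynomial (Fin (N + 1)) K}
    (hdeg : F.IsHomogeneous n) (hIrr : Irreducible F) (hN : 1 ≤ N) :
    ∃ (M : Type) (_ : Field M) (_ : Algebra K M) (h : Fin (N + 1) → M) (j : Fin (N + 1))
      (m r : ℕ) (e : Fin (N + 1) → Fin r → M) (k : Fin r → Fin (N + 1)),
      h j = 1 ∧ IntermediateField.adjoin K (Set.range h) = ⊤ ∧ Algebra.trdeg K M = m ∧
      m + r = N ∧ 1 ≤ r ∧ (∀ l, e (k l) = Pi.single l 1) ∧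
      (∀ p, aeval (fun i => linForm (e i)) p = 0 ↔ F ∣ p) ∧
      (∀ i, aeval (fun i => linForm (e i)) (pderiv i F) =
        C (h i) * aeval (fun i => linForm (e i)) (pderiv j F)) ∧ ¬ F ∣ pderiv j F := by
  classical
  obtain ⟨j, hj⟩ := exists_not_dvd_pderiv hdeg hIrr
  obtain ⟨Q, _, _, Φ, hΦ, hQtop⟩ := exists_functionField hIrr
  obtain ⟨d, hd, hNd⟩ := exists_trdeg_functionField Φ hΦ hQtop
  let x : Fin (N + 1) → Q := fun i => Φ (X i)
  let f : Fin (N + 1) → Q := fun i => Φ (pderiv i F)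
  have hfj : f j ≠ 0 := fun h => hj ((hΦ _).1 h)
  let h : Fin (N + 1) → Q := fun i => f i / f j
  have hf : ∀ i, f i = f j * h i := fun i => (mul_div_cancel₀ (f i) hfj).symm
  obtain ⟨M, _, _, _, _, h', hh', hadj⟩ := exists_subfield_of_family (K := K) h
  have hj1 : h' j = 1 := (algebraMap M Q).injective <| by
    rw [hh', map_one]; exact div_self hfj
  have hess : Algebra.EssFiniteType K Q := by
    have := isFractionRing_range Φ hQtop
    have : Algebra.FiniteType K Φ.range := .of_surjective Φ.rangeRestrict Φ.rangeRestrict_surjective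
    have : Algebra.EssFiniteType Φ.range Q := .of_isLocalization _ (nonZeroDivisors Φ.range)
    exact .comp K Φ.range Q
  have hessM : Algebra.EssFiniteType M Q := .of_comp K M Q
  have hMQ : Algebra.trdeg K M ≤ d := by
    rw [← hd, ← trdeg_add_eq K M (A := Q)]; exact self_le_add_right _ _
  obtain ⟨m, hm⟩ := Cardinal.lt_aleph0.1 (hMQ.trans_lt Cardinal.natCast_lt_aleph0)
  have heuler : ∑ i, x i * f i = 0 := by
    have := congrArg Φ hdeg.sum_X_mul_pderiv
    simpa [(hΦ F).2 dvd_rfl, x, f] using this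
  have h0 : ∑ i, x i * h i = 0 := by
    have : ∑ i, x i * f i = f j * ∑ i, x i * h i := by
      rw [Finset.mul_sum]
      exact Finset.sum_congr rfl fun i _ => by rw [hf i]; ring
    rw [this] at heuler
    exact (mul_eq_zero.1 heuler).resolve_left hfj
  have hfD : ∑ i, h i • KaehlerDifferential.D K Q (x i) = 0 := by
    have := D_eq_sum_pderiv Φ F
    rw [(hΦ F).2 dvd_rfl, map_zero] at this
    have h1 : ∑ i, f i • KaehlerDifferential.D K Q (x i) =
        f j • ∑ i, h i • KaehlerDifferential.D K Q (x i) := by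
      rw [Finset.smul_sum]
      exact Finset.sum_congr rfl fun i _ => by rw [hf i, mul_smul]
    exact (smul_eq_zero.1 (h1.symm.trans this.symm)).resolve_left hfj
  have h1 : ∑ i, x i • KaehlerDifferential.D K Q (h i) = 0 := by
    have := congrArg (KaehlerDifferential.D K Q) h0
    simpa only [map_sum, Derivation.leibniz, Finset.sum_add_distrib, hfD, add_zero, map_zero]
      using this
  have h0' : ∑ i, x i * algebraMap M Q (h' i) = 0 := by simp only [hh', h0]
  have h1' : ∑ i, x i • KaehlerDifferential.D K Q (algebraMap M Q (h' i)) = 0 := by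
    simp only [hh', h1]
  obtain ⟨r, k, e, hr, hxe, hek⟩ := exists_subfamily_basis (M := M) x
  have hle : r + m + 1 ≤ N + 1 := by
    have := finrank_span_add_trdeg_add_one_le h' j hj1 hadj x h0' h1' hm
    rwa [← hr, Fintype.card_fin] at this
  have htop : IntermediateField.adjoin M (Set.range (x ∘ k)) = ⊤ := by
    rw [eq_top_iff]
    have hsub : IntermediateField.adjoin K (Set.range x) ≤
        (IntermediateField.adjoin M (Set.range (x ∘ k))).restrictScalars K := by
      rw [IntermediateField.adjoin_le_iff]
      rintro _ ⟨i, rfl⟩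
      rw [hxe i]
      refine sum_mem fun l _ => ?_
      rw [Algebra.smul_def]
      exact mul_mem (IntermediateField.algebraMap_mem (IntermediateField.adjoin M _) _)
        (IntermediateField.subset_adjoin M _ ⟨l, rfl⟩)
    intro z _
    exact hsub (hQtop ▸ trivial)
  obtain ⟨hmr, hind⟩ := algebraicIndependent_of_adjoin_eq_top (x ∘ k) htop hm hd (by omega)
  have hcomp : ∀ p, aeval (x ∘ k) (aeval (fun i => linForm (e i)) p) = Φ p := by
    intro p
    have h2 : ∀ i, aeval (x ∘ k) (linForm (e i)) = x i := fun i => by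
      simp [linForm, hxe i, Algebra.smul_def]
    have : ((aeval (R := M) (x ∘ k)).restrictScalars K).comp (aeval fun i => linForm (e i)) = Φ :=
      MvPolynomial.algHom_ext fun i => by simp [h2, x]
    exact DFunLike.congr_fun this p
  refine ⟨M, inferInstance, inferInstance, h', j, m, r, e, k, hj1, hadj, hm,
    by omega, ?_, hek, fun p => ?_, fun i => ?_, hj⟩
  · by_contra hr0
    have hx0 : ∀ i, x i = 0 := fun i => by
      rw [hxe i]
      have : IsEmpty (Fin r) := by
        rw [show r = 0 by omega]; infer_instance
      simp
    have hbot : IntermediateField.adjoin K (Set.range x) = ⊥ := by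
      rw [IntermediateField.adjoin_eq_bot_iff]
      rintro _ ⟨i, rfl⟩
      rw [hx0 i]; exact zero_mem _
    have hbt : (⊥ : IntermediateField K Q) = ⊤ := hbot.symm.trans hQtop
    have : Algebra.IsAlgebraic K Q := by
      refine ⟨fun z => ?_⟩
      have hz : z ∈ (⊥ : IntermediateField K Q) := hbt ▸ trivial
      obtain ⟨c, rfl⟩ := IntermediateField.mem_bot.1 hz
      exact isAlgebraic_algebraMap c
    rw [trdeg_eq_zero] at hd
    norm_cast at hd
    omega
  · rw [← hΦ, ← hcomp]
    exact (map_eq_zero_iff _ hind).symm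
  · apply hind
    change aeval (x ∘ k) _ = aeval (x ∘ k) _
    rw [map_mul, hcomp, hcomp, aeval_C, hh', mul_comm]
    exact hf i

end hypersurface

section extension

variable {K M L : Type} [Field K] [Field M] [Field L] [Algebra K M] [Algebra K L] [Algebra M L]
  [IsScalarTower K M L]

theorem algebraMap_mem_of_adjoin_eq_top {ι : Type} {h : ι → M}
    (hh : IntermediateField.adjoin K (Set.range h) = ⊤) {E : IntermediateField K L}
    (hE : ∀ i, algebraMap M L (h i) ∈ E) (z : M) : algebraMap M L z ∈ E := by
  have hle : IntermediateField.adjoin K (Set.range h) ≤ E.comap (IsScalarTower.toAlgHom K M L) :=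
    IntermediateField.adjoin_le_iff.2 (by rintro _ ⟨i, rfl⟩; exact hE i)
  exact hle (hh ▸ trivial : z ∈ IntermediateField.adjoin K (Set.range h))

/-- A subextension of the fraction field of `B` which contains `B` is everything. -/
theorem eq_top_of_algebraMap_mem {B : Type} [CommRing B] [IsDomain B] [Algebra B L]
    [IsFractionRing B L] {E : IntermediateField K L} (hE : ∀ b, algebraMap B L b ∈ E) : E = ⊤ := by
  refine eq_top_iff.2 fun z _ => ?_
  obtain ⟨a, b, -, rfl⟩ := IsFractionRing.div_surjective (A := B) z
  exact div_mem (hE a) (hE b)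

theorem trdeg_fractionField (B : Type) [CommRing B] [IsDomain B] [Algebra M B] [Algebra B L]
    [IsFractionRing B L] [IsScalarTower M B L] [FaithfulSMul M B] :
    Algebra.trdeg K L = Algebra.trdeg K M + Algebra.trdeg M B := by
  have : Algebra.IsAlgebraic B L := IsLocalization.isAlgebraic _ (nonZeroDivisors B)
  have : FaithfulSMul B L := (faithfulSMul_iff_algebraMap_injective B L).2
    (IsFractionRing.injective B L)
  rw [← trdeg_add_eq K M (A := L), ← trdeg_add_eq M B (A := L), trdeg_eq_zero (R := B) (A := L), add_zero]

end extension

section eval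

variable {K : Type} [Field K]

theorem aeval_mul_of_isHomogeneous {σ A : Type} [CommRing A] [Algebra K A] {n : ℕ}
    {F : MvPolynomial σ K} (hF : F.IsHomogeneous n) (t : A) (x : σ → A) :
    aeval (fun i => t * x i) F = t ^ n * aeval x F := by
  classical
  simp only [aeval_def, eval₂_eq, Finset.mul_sum]
  refine Finset.sum_congr rfl fun d hd => ?_
  have hdn : ∑ i ∈ d.support, d i = n := by
    have := hF (mem_support_iff.1 hd)
    rwa [Finsupp.weight_apply, Finsupp.sum_congr (g2 := fun _ a => a) (by simp)] at this
  simp only [mul_pow, Finset.prod_mul_distrib, Finset.prod_pow_eq_pow_sum, hdn]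
  ring

/-- A polynomial vanishing at the zeros of an irreducible polynomial is divisible by it. -/
theorem dvd_of_forall_eval_eq_zero [IsAlgClosed K] {σ : Type} [Finite σ] {F H : MvPolynomial σ K}
    (hF : Irreducible F) (h : ∀ v, eval v F = 0 → eval v H = 0) : F ∣ H := by
  have : (Ideal.span {F}).IsPrime := (Ideal.span_singleton_prime hF.ne_zero).2 hF.prime
  rw [← Ideal.mem_span_singleton, ← IsPrime.vanishingIdeal_zeroLocus (K := K) (Ideal.span {F})]
  intro v hv
  rw [zeroLocus_span] at hv
  exact h v (hv F rfl)

end eval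

section dual

variable {K : Type} [Field K] {N : ℕ}

theorem affVanishing_projCone_projClosure (S : Set (PP K N)) :
    affVanishing K (projCone K (projClosure K S)) = affVanishing K (projCone K S) := by
  refine le_antisymm (fun g hg v => ?_) fun g hg v => ?_
  · rintro ⟨x, hx, hv⟩
    exact hg v ⟨x, Set.mem_sInter.2 fun C hC => hC.2 hx, hv⟩
  · rintro ⟨x, hx, hv⟩
    exact Set.mem_sInter.1 hx {x | ∀ f ∈ ({g} : Set _), ∀ v ∈ x.submodule, eval v f = 0}
      ⟨⟨_, rfl⟩, fun y hy f hf w hw => by rw [Set.mem_singleton_iff.1 hf]; exact hg w ⟨y, hy, hw⟩⟩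
      g rfl v hv

theorem smoothAt_mk {n : ℕ} {F : MvPolynomial (Fin (N + 1)) K} (hdeg : F.IsHomogeneous n)
    {v : Fin (N + 1) → K} (hv : v ≠ 0) (h0 : eval v F = 0) (hg : gradVec K F v ≠ 0) :
    SmoothAt K F (Projectivization.mk K v hv) := by
  refine ⟨fun w hw => ?_, fun hs => hg (hs.2 v ?_)⟩
  · rw [Projectivization.submodule_mk, Submodule.mem_span_singleton] at hw
    obtain ⟨a, rfl⟩ := hw
    have := aeval_mul_of_isHomogeneous hdeg a v
    exact this.trans (mul_eq_zero_of_right _ h0)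
  · rw [Projectivization.submodule_mk]
    exact Submodule.mem_span_singleton_self v

theorem eval_smul_gradVec (F g : MvPolynomial (Fin (N + 1)) K) (v : Fin (N + 1) → K) (c : K) :
    eval (c • gradVec K F v) g = eval v (aeval (fun i => C c * pderiv i F) g) := by
  rw [← coe_aeval_eq_eval, ← coe_aeval_eq_eval, RingHom.coe_coe, RingHom.coe_coe,
    ← AlgHom.comp_apply]
  congr 1
  ext i
  simp [gradVec]

variable [IsAlgClosed K]

/-- A polynomial vanishes on the cone over the dual variety iff it vanishes at all multiples of
the gradient along the hypersurface. -/
theorem mem_affVanishing_dualVariety_iff {n : ℕ} {F : MvPolynomial (Fin (N + 1)) K}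
    (hdeg : F.IsHomogeneous n) (hIrr : Irreducible F) {i₀ j : Fin (N + 1)} (hi : ¬ F ∣ X i₀)
    (hj : ¬ F ∣ pderiv j F) (g : MvPolynomial (Fin (N + 1)) K) :
    g ∈ affVanishing K (projCone K (dualVariety K F)) ↔
      ∀ c : K, F ∣ aeval (fun i => C c * pderiv i F) g := by
  constructor
  · intro hg c
    have key : F ∣ aeval (fun i => C c * pderiv i F) g * (pderiv j F * X i₀) := by
      refine dvd_of_forall_eval_eq_zero hIrr fun v hv => ?_
      rw [map_mul, map_mul, eval_X]
      by_cases hjv : eval v (pderiv j F) = 0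
      · rw [hjv, zero_mul, mul_zero]
      by_cases hiv : v i₀ = 0
      · rw [hiv, mul_zero, mul_zero]
      have hv0 : v ≠ 0 := fun h => hiv (by rw [h, Pi.zero_apply])
      have hgr : gradVec K F v ≠ 0 := fun h => hjv (congrFun h j)
      rw [← eval_smul_gradVec, hg, zero_mul]
      refine ⟨_, ⟨_, smoothAt_mk hdeg hv0 hv hgr, v, ?_, hgr, rfl⟩, ?_⟩
      · rw [Projectivization.submodule_mk]
        exact Submodule.mem_span_singleton_self v
      · rw [Projectivization.submodule_mk]
        exact Submodule.smul_mem _ c (Submodule.mem_span_singleton_self _)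
    rcases hIrr.prime.dvd_or_dvd key with h | h
    · exact h
    · exact absurd h (hIrr.prime.not_dvd_mul hj hi)
  · rintro hg w ⟨y, ⟨x, hx, v, hv, hnz, rfl⟩, hw⟩
    rw [Projectivization.submodule_mk, Submodule.mem_span_singleton] at hw
    obtain ⟨c, rfl⟩ := hw
    obtain ⟨q, hq⟩ := hg c
    rw [eval_smul_gradVec, hq, map_mul, hx.1 v hv, zero_mul]

variable {M : Type} [Field M] [Algebra K M]

/-- If the Gauss image has function field `M` of transcendence degree `m`, the dual variety has
dimension `m`. -/
theorem hasProjDim_dualVariety {n m r : ℕ} {F : MvPolynomial (Fin (N + 1)) K}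
    (hdeg : F.IsHomogeneous n) (hIrr : Irreducible F) {h : Fin (N + 1) → M} {j : Fin (N + 1)}
    {e : Fin (N + 1) → Fin r → M} {k : Fin r → Fin (N + 1)} (hj : h j = 1)
    (hh : IntermediateField.adjoin K (Set.range h) = ⊤) (hm : Algebra.trdeg K M = m) (hr : 1 ≤ r)
    (hk : ∀ l, e (k l) = Pi.single l 1)
    (hF : ∀ p, aeval (fun i => linForm (e i)) p = 0 ↔ F ∣ p)
    (hgrad : ∀ i, aeval (fun i => linForm (e i)) (pderiv i F) =
      C (h i) * aeval (fun i => linForm (e i)) (pderiv j F)) (hjF : ¬ F ∣ pderiv j F) :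
    HasProjDim K (projClosure K (dualVariety K F)) m := by
  let B := Polynomial M
  let L := FractionRing B
  let ψ₀ : MvPolynomial (Fin (N + 1)) K →ₐ[K] B := aeval fun i => Polynomial.C (h i) * Polynomial.X
  let ψ : MvPolynomial (Fin (N + 1)) K →ₐ[K] L := (IsScalarTower.toAlgHom K B L).comp ψ₀
  let f := aeval (R := K) (fun i => linForm (e i)) (pderiv j F)
  have hf : f ≠ 0 := fun h0 => hjF ((hF _).1 h0)
  have hsub : ∀ (c : K) g, aeval (fun i => linForm (e i)) (aeval (fun i => C c * pderiv i F) g) =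
      Polynomial.aeval (algebraMap K (MvPolynomial (Fin r) M) c * f) (ψ₀ g) := by
    intro c g
    rw [← AlgHom.comp_apply, ← AlgHom.restrictScalars_apply K (Polynomial.aeval _),
      ← AlgHom.comp_apply]
    congr 1
    ext i : 1
    simp only [AlgHom.comp_apply, aeval_X, map_mul, ψ₀, AlgHom.restrictScalars_apply,
      Polynomial.aeval_C, Polynomial.aeval_X, MvPolynomial.algebraMap_eq, aeval_C, f]
    rw [hgrad]
    ring
  have hi : ¬ F ∣ X (k ⟨0, hr⟩) := by
    rw [← hF, aeval_X, hk]
    have : linForm (Pi.single (⟨0, hr⟩ : Fin r) (1 : M)) = X ⟨0, hr⟩ := by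
      rw [linForm, Finset.sum_eq_single_of_mem ⟨0, hr⟩ (Finset.mem_univ _) fun l _ hl => by
        rw [Pi.single_eq_of_ne hl, map_zero, zero_mul], Pi.single_eq_same, map_one, one_mul]
    rw [this]
    exact X_ne_zero _
  have hker : affVanishing K (projCone K (projClosure K (dualVariety K F))) = RingHom.ker ψ := by
    ext g
    rw [affVanishing_projCone_projClosure, mem_affVanishing_dualVariety_iff hdeg hIrr hi hjF,
      RingHom.mem_ker]
    have hψ : ψ g = 0 ↔ ψ₀ g = 0 := map_eq_zero_iff _ (IsFractionRing.injective B L)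
    simp only [hψ, ← hF, hsub]
    refine ⟨fun hg => ?_, fun hg c => by rw [hg, map_zero]⟩
    have hinj : Function.Injective fun c : K => algebraMap K (MvPolynomial (Fin r) M) c * f :=
      (mul_left_injective₀ hf).comp (FaithfulSMul.algebraMap_injective K _)
    have hz : (ψ₀ g).map (algebraMap M (MvPolynomial (Fin r) M)) = 0 := by
      refine Polynomial.eq_zero_of_infinite_isRoot _ ((Set.infinite_range_of_injective hinj).mono ?_)
      rintro _ ⟨c, rfl⟩
      rw [Set.mem_ofPred_eq, Polynomial.IsRoot.def, ← Polynomial.eval₂_eq_eval_map,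
        ← Polynomial.aeval_def, hg c]
    exact (Polynomial.map_eq_zero_iff (FaithfulSMul.algebraMap_injective _ _)).1 hz
  have htop : IntermediateField.adjoin K (Set.range fun i => ψ (X i)) = ⊤ := by
    set E := IntermediateField.adjoin K (Set.range fun i => ψ (X i)) with hE
    have hX : ∀ i, ψ (X i) = algebraMap M L (h i) * algebraMap B L Polynomial.X := fun i => by
      rw [IsScalarTower.algebraMap_apply M B L, ← map_mul]
      exact congrArg (algebraMap B L) (aeval_X _ i)
    have hmem : ∀ i, ψ (X i) ∈ E := fun i => IntermediateField.subset_adjoin _ _ ⟨i, rfl⟩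
    have hT : algebraMap B L Polynomial.X ∈ E := by
      have := hmem j
      rwa [hX, hj, map_one, one_mul] at this
    have hT0 : algebraMap B L Polynomial.X ≠ 0 :=
      (map_ne_zero_iff _ (IsFractionRing.injective B L)).2 Polynomial.X_ne_zero
    have hM : ∀ z, algebraMap M L z ∈ E := algebraMap_mem_of_adjoin_eq_top hh fun i => by
      have := div_mem (hmem i) hT
      rwa [hX, mul_div_cancel_right₀ _ hT0] at this
    refine eq_top_of_algebraMap_mem (B := B) fun b => ?_
    induction b using Polynomial.induction_on' with
    | add p q hp hq => rw [map_add]; exact add_mem hp hq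
    | monomial s a =>
      rw [← Polynomial.C_mul_X_pow_eq_monomial, map_mul, map_pow]
      refine mul_mem ?_ (pow_mem hT s)
      have := hM a
      rwa [IsScalarTower.algebraMap_apply M B L] at this
  obtain ⟨d, hd, hd'⟩ := exists_ringKrullDim_quotient_ker_eq ψ htop
  rw [HasProjDim, affDim, hker, hd]
  rw [trdeg_fractionField (M := M) B, hm, Polynomial.trdeg_of_isDomain] at hd'
  have : m + 1 = d := by exact_mod_cast hd'
  rw [this]

end dual

section fano

variable {K : Type} [Field K] {N : ℕ}

/-- A linear functional killing all values of a polynomial kills its coefficients. -/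
theorem linearMap_coeff_eq_zero [Infinite K] {τ R A : Type} [Finite τ] [CommRing R] [Algebra K R]
    [Field A] [Algebra K A] (Λ : R →ₗ[K] A) {p : MvPolynomial τ R}
    (h : ∀ c : τ → K, Λ (eval (fun i => algebraMap K R (c i)) p) = 0) (d : τ →₀ ℕ) :
    Λ (coeff d p) = 0 := by
  classical
  cases nonempty_fintype τ
  let q : MvPolynomial τ A := ∑ d ∈ p.support, monomial d (Λ (coeff d p))
  have hq : q = 0 := by
    refine funext_set (fun _ => Set.range (algebraMap K A))
      (fun _ => Set.infinite_range_of_injective (FaithfulSMul.algebraMap_injective K A))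
      fun x hx => ?_
    choose c hc using fun i => hx i trivial
    obtain rfl : (fun i => algebraMap K A (c i)) = x := funext hc
    rw [map_zero, ← h c, eval_eq' _ p, map_sum, map_sum]
    refine Finset.sum_congr rfl fun d _ => ?_
    rw [eval_monomial, Finsupp.prod_fintype _ _ fun i => pow_zero _]
    simp only [← map_pow, ← map_prod]
    rw [mul_comm (coeff d p), ← Algebra.smul_def, map_smul, Algebra.smul_def, mul_comm]
  have := congrArg (coeff d) hq
  rw [coeff_zero, coeff_sum] at this
  simp only [coeff_monomial, Finset.sum_ite_eq'] at this
  by_cases hd : d ∈ p.support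
  · rwa [if_pos hd] at this
  · rw [notMem_support_iff.1 hd, map_zero]

/-- The value of a polynomial at the linear combination of the frame with coefficients `c`. -/
def atParam (N : ℕ) (c : Fin 2 → K) :
    MvPolynomial (Fin (N + 1)) K →ₐ[K] MvPolynomial (Fin 2 × Fin (N + 1)) K :=
  aeval fun j => ∑ b, C (c b) * X (b, j)

theorem eval_fano_generic (F : MvPolynomial (Fin (N + 1)) K) (c : Fin 2 → K) :
    eval (fun i => algebraMap K (MvPolynomial (Fin 2 × Fin (N + 1)) K) (c i))
      (aeval (fun j : Fin (N + 1) =>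
        (X 0 : MvPolynomial (Fin 2) (MvPolynomial (Fin 2 × Fin (N + 1)) K)) * C (X (0, j)) +
          X 1 * C (X (1, j))) F) = atParam N c F := by
  rw [atParam, ← aeval_eq_eval, ← AlgHom.restrictScalars_apply K, ← AlgHom.comp_apply]
  congr 1
  ext i : 1
  simp [Fin.sum_univ_two, MvPolynomial.algebraMap_eq]

theorem atParam_mem_fanoIdeal (F : MvPolynomial (Fin (N + 1)) K) (c : Fin 2 → K) :
    atParam N c F ∈ fanoIdeal K F := by
  rw [← eval_fano_generic, eval_eq']
  exact Ideal.sum_mem _ fun d _ => Ideal.mul_mem_right _ _ (Ideal.subset_span ⟨d, rfl⟩)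

theorem linearMap_eq_zero_of_mem_fanoIdeal [Infinite K] {A : Type} [Field A] [Algebra K A]
    (Λ : MvPolynomial (Fin 2 × Fin (N + 1)) K →ₗ[K] A) {F : MvPolynomial (Fin (N + 1)) K}
    (h : ∀ c, Λ (atParam N c F) = 0) {g : MvPolynomial (Fin 2 × Fin (N + 1)) K}
    (hg : ∃ d : Fin 2 →₀ ℕ, g = coeff d
      (aeval (fun j : Fin (N + 1) =>
        (X 0 : MvPolynomial (Fin 2) (MvPolynomial (Fin 2 × Fin (N + 1)) K)) * C (X (0, j)) +
          X 1 * C (X (1, j))) F)) : Λ g = 0 := by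
  obtain ⟨d, rfl⟩ := hg
  exact linearMap_coeff_eq_zero Λ (fun c => by rw [eval_fano_generic, h]) d

theorem fanoIdeal_le_ker [Infinite K] {A : Type} [Field A] [Algebra K A]
    (φ : MvPolynomial (Fin 2 × Fin (N + 1)) K →ₐ[K] A) {F : MvPolynomial (Fin (N + 1)) K}
    (h : ∀ c, φ (atParam N c F) = 0) : fanoIdeal K F ≤ RingHom.ker φ :=
  Ideal.span_le.2 fun _ hg => linearMap_eq_zero_of_mem_fanoIdeal φ.toLinearMap h hg

theorem pderiv_atParam (c : Fin 2 → K) (p : MvPolynomial (Fin (N + 1)) K)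
    (i : Fin 2 × Fin (N + 1)) :
    pderiv i (atParam N c p) = C (c i.1) * atParam N c (pderiv i.2 p) := by
  classical
  induction p using MvPolynomial.induction_on with
  | C a => simp [← algebraMap_eq]
  | add p q hp hq => simp [hp, hq, mul_add]
  | mul_X p l hp =>
    have hl : pderiv i (atParam N c (X l)) = if l = i.2 then C (c i.1) else 0 := by
      obtain ⟨b, t⟩ := i
      simp only [atParam, aeval_X, map_sum, pderiv_C_mul, pderiv_X, Pi.single_apply,
        Prod.mk.injEq]
      rcases eq_or_ne l t with rfl | hlt
      · simp
      · simp [hlt]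
    rw [map_mul, Derivation.leibniz, Derivation.leibniz, hp, hl, pderiv_X, Pi.single_apply]
    split_ifs <;> simp <;> ring

/-- A tangent vector to the space of frames along which the equations of the Fano scheme
vanish to first order. -/
theorem sum_mul_pderiv_eq_zero_of_mem_fanoIdeal [Infinite K] {A : Type} [Field A] [Algebra K A]
    (φ : MvPolynomial (Fin 2 × Fin (N + 1)) K →ₐ[K] A) {F : MvPolynomial (Fin (N + 1)) K}
    (h : ∀ c, φ (atParam N c F) = 0) {a : Fin 2 × Fin (N + 1) → A}
    (ha : ∀ c : Fin 2 → K, ∑ i, a i * (algebraMap K A (c i.1) *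
      φ (atParam N c (pderiv i.2 F))) = 0)
    {g : MvPolynomial (Fin 2 × Fin (N + 1)) K} (hg : g ∈ fanoIdeal K F) :
    ∑ i, a i * φ (pderiv i g) = 0 := by
  let Λ : MvPolynomial (Fin 2 × Fin (N + 1)) K →ₗ[K] A :=
    ∑ i, (LinearMap.mulLeft K (a i)) ∘ₗ φ.toLinearMap ∘ₗ (pderiv i).toLinearMap
  have hΛ : ∀ g, Λ g = ∑ i, a i * φ (pderiv i g) := fun g => by
    simp [Λ, LinearMap.sum_apply]
  induction hg using Submodule.span_induction with
  | mem g hg =>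
    rw [← hΛ]
    refine linearMap_eq_zero_of_mem_fanoIdeal Λ (fun c => ?_) hg
    rw [hΛ, ← ha c]
    refine Finset.sum_congr rfl fun i _ => ?_
    rw [pderiv_atParam, map_mul, ← algebraMap_eq, AlgHom.commutes]
  | zero => simp
  | add x y _ _ hx hy => simp only [map_add, mul_add, Finset.sum_add_distrib, hx, hy, add_zero]
  | smul x y hy hy0 =>
    have hφ : φ y = 0 := fanoIdeal_le_ker φ h hy
    have : ∀ i, a i * φ (pderiv i (x • y)) = φ x * (a i * φ (pderiv i y)) := fun i => by
      rw [smul_eq_mul, Derivation.leibniz, map_add, smul_eq_mul, smul_eq_mul, map_mul, map_mul, hφ]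
      ring
    simp only [this, ← Finset.mul_sum, hy0, mul_zero]

theorem eval_atParam (c : Fin 2 → K) (F : MvPolynomial (Fin (N + 1)) K)
    (p : Fin 2 × Fin (N + 1) → K) :
    eval p (atParam N c F) = eval (∑ b, c b • fun j => p (b, j)) F := by
  rw [atParam, ← aeval_eq_eval, ← aeval_eq_eval, ← AlgHom.comp_apply]
  congr 1
  ext i : 1
  simp

/-- The zeros of the Fano ideal are the frames contained in the lines of the hypersurface. -/
theorem mem_frameCone_fanoSet {F : MvPolynomial (Fin (N + 1)) K} (hcov : CoveredByLines K F)
    (hne : (fanoSet K F).Nonempty) {p : Fin 2 × Fin (N + 1) → K}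
    (hp : ∀ g ∈ fanoIdeal K F, eval p g = 0) : p ∈ frameCone K 2 N (fanoSet K F) := by
  have hF : ∀ c : Fin 2 → K, eval (∑ b, c b • fun j => p (b, j)) F = 0 := fun c => by
    rw [← eval_atParam, hp _ (atParam_mem_fanoIdeal F c)]
  have hspan : ∀ u ∈ Submodule.span K (Set.range fun (b : Fin 2) j => p (b, j)), eval u F = 0 := by
    intro u hu
    obtain ⟨c, rfl⟩ := (Submodule.mem_span_range_iff_exists_fun K).1 hu
    exact hF c
  have hmem : ∀ b : Fin 2, (fun j => p (b, j)) ∈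
      Submodule.span K (Set.range fun (b : Fin 2) j => p (b, j)) := fun b =>
    Submodule.subset_span ⟨b, rfl⟩
  by_cases hli : LinearIndependent K fun (b : Fin 2) j => p (b, j)
  · exact ⟨⟨_, (finrank_span_eq_card hli).trans (Fintype.card_fin 2)⟩,
      fun x hx v hv => hspan v (hx hv), hmem⟩
  have hlt : Module.finrank K (Submodule.span K (Set.range fun (b : Fin 2) j => p (b, j))) ≤ 1 := by
    have h1 : Module.finrank K (Submodule.span K (Set.range fun (b : Fin 2) j => p (b, j))) ≤ 2 :=
      (finrank_range_le_card (R := K) fun (b : Fin 2) j => p (b, j)).trans_eq (Fintype.card_fin 2)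
    have h2 : Module.finrank K (Submodule.span K (Set.range fun (b : Fin 2) j => p (b, j))) ≠ 2 :=
      fun h => hli (linearIndependent_iff_card_eq_finrank_span.2 
        ((Fintype.card_fin 2).trans h.symm))
    omega
  obtain ⟨⟨u, hu⟩, hgen⟩ := finrank_le_one_iff.1 hlt
  have hpu : ∀ b, ∃ c : K, c • u = fun j => p (b, j) := fun b => by
    obtain ⟨c, hc⟩ := hgen ⟨_, hmem b⟩
    exact ⟨c, congrArg Subtype.val hc⟩
  by_cases hu0 : u = 0
  · obtain ⟨W, hW⟩ := hne
    refine ⟨W, hW, fun b => ?_⟩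
    obtain ⟨c, hc⟩ := hpu b
    rw [← hc, hu0, smul_zero]
    exact W.1.zero_mem
  · obtain ⟨W, hW, hx⟩ := hcov (Projectivization.mk K u hu0) fun v hv => by
      rw [Projectivization.submodule_mk] at hv
      exact hspan v ((Submodule.span_singleton_le_iff_mem _ _).2 hu hv)
    refine ⟨W, hW, fun b => ?_⟩
    obtain ⟨c, hc⟩ := hpu b
    rw [← hc]
    refine W.1.smul_mem c (hx ?_)
    rw [Projectivization.submodule_mk]
    exact Submodule.mem_span_singleton_self u

/-- The dimension of the Fano family bounds the dimension of the zeros of any prime containing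
the Fano ideal. -/
theorem ringKrullDim_quotient_le_of_fanoIdeal_le [IsAlgClosed K]
    {F : MvPolynomial (Fin (N + 1)) K} (hcov : CoveredByLines K F) {δ : ℕ}
    (hdim : HasGrDim K (fanoSet K F) δ) (P : Ideal (MvPolynomial (Fin 2 × Fin (N + 1)) K))
    [P.IsPrime] (hP : fanoIdeal K F ≤ P) :
    ringKrullDim (MvPolynomial (Fin 2 × Fin (N + 1)) K ⧸ P) ≤ ((δ + 2 * 2 : ℕ) : WithBot ℕ∞) := by
  have hne : (fanoSet K F).Nonempty := by
    by_contra hne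
    rw [Set.not_nonempty_iff_eq_empty] at hne
    have htop : affVanishing K (frameCone K 2 N (fanoSet K F)) = ⊤ :=
      eq_top_iff.2 fun g _ v ⟨W, hW, _⟩ => by rw [hne] at hW; exact hW.elim
    rw [HasGrDim, affDim, htop] at hdim
    have : Subsingleton (MvPolynomial (Fin 2 × Fin (N + 1)) K ⧸
        (⊤ : Ideal (MvPolynomial (Fin 2 × Fin (N + 1)) K))) :=
      Ideal.Quotient.subsingleton_iff.2 rfl
    rw [ringKrullDim_eq_bot_of_subsingleton] at hdim
    exact WithBot.bot_ne_coe hdim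
  have hle : affVanishing K (frameCone K 2 N (fanoSet K F)) ≤ P := fun g hg => by
    rw [← IsPrime.vanishingIdeal_zeroLocus (K := K) P]
    exact fun v hv => hg v (mem_frameCone_fanoSet hcov hne fun q hq => hv q (hP hq))
  rw [← hdim]
  exact ringKrullDim_le_of_surjective _ (Ideal.Quotient.factor_surjective hle)

end fano

section genericFrame

/-- The pairs of vectors whose members are orthogonal to a given vector. -/
def orthogonalPairs {L ι : Type} [Field L] [Fintype ι] (h : ι → L) : Submodule L (Fin 2 × ι → L) :=
  LinearMap.ker (LinearMap.pi fun b => ∑ j, h j • LinearMap.proj (R := L) (φ := fun _ => L) (b, j))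

theorem mem_orthogonalPairs {L ι : Type} [Field L] [Fintype ι] {h : ι → L} {a : Fin 2 × ι → L} :
    a ∈ orthogonalPairs h ↔ ∀ b, ∑ j, h j * a (b, j) = 0 := by
  simp [orthogonalPairs, funext_iff, LinearMap.sum_apply]

theorem two_mul_card_le_finrank_orthogonalPairs {L ι : Type} [Field L] [Fintype ι] (h : ι → L) :
    2 * Fintype.card ι ≤ Module.finrank L (orthogonalPairs h) + 2 := by
  have h1 := LinearMap.finrank_range_add_finrank_ker (LinearMap.pi fun b : Fin 2 =>
    ∑ j, h j • LinearMap.proj (R := L) (φ := fun _ => L) (b, j))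
  have h2 := Submodule.finrank_le (LinearMap.range (LinearMap.pi fun b : Fin 2 =>
    ∑ j, h j • LinearMap.proj (R := L) (φ := fun _ => L) (b, j)))
  rw [Module.finrank_fintype_fun_eq_card, Fintype.card_prod, Fintype.card_fin] at h1
  rw [Module.finrank_fintype_fun_eq_card, Fintype.card_fin] at h2
  unfold orthogonalPairs
  omega

variable {K M : Type} [Field K] [Field M] [Algebra K M] {N r : ℕ}

/-- The generic frame of the linear space with basis `e` over `M`. -/
def genericFrame (e : Fin (N + 1) → Fin r → M) : MvPolynomial (Fin 2 × Fin (N + 1)) K →ₐ[K]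
    FractionRing (MvPolynomial (Fin 2 × Fin r) M) :=
  aeval fun i => algebraMap (MvPolynomial (Fin 2 × Fin r) M) _ (∑ l, C (e i.2 l) * X (i.1, l))

/-- The point with parameters `c` on the generic frame. -/
def genericPoint (M : Type) [Field M] [Algebra K M] (r : ℕ) (c : Fin 2 → K) :
    MvPolynomial (Fin r) M →ₐ[M] FractionRing (MvPolynomial (Fin 2 × Fin r) M) :=
  aeval fun l => algebraMap (MvPolynomial (Fin 2 × Fin r) M) _
    (∑ b, C (algebraMap K M (c b)) * X (b, l))

theorem genericFrame_atParam (e : Fin (N + 1) → Fin r → M) (c : Fin 2 → K)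
    (p : MvPolynomial (Fin (N + 1)) K) :
    genericFrame e (atParam N c p) = genericPoint M r c (aeval (fun i => linForm (e i)) p) := by
  rw [← AlgHom.restrictScalars_apply K (genericPoint M r c), ← AlgHom.comp_apply,
    ← AlgHom.comp_apply]
  congr 1
  ext i : 1
  simp only [AlgHom.comp_apply, AlgHom.restrictScalars_apply, atParam, aeval_X, linForm, map_sum,
    map_mul, genericFrame, genericPoint, Finset.mul_sum, ← algebraMap_eq, AlgHom.commutes,
    ← IsScalarTower.algebraMap_apply]
  rw [Finset.sum_comm]
  refine Finset.sum_congr rfl fun l _ => Finset.sum_congr rfl fun b _ => ?_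
  ring

theorem genericPoint_single_ne_zero {f : MvPolynomial (Fin r) M} (hf : f ≠ 0) :
    genericPoint M r (Pi.single 0 1 : Fin 2 → K) f ≠ 0 := by
  have : genericPoint M r (Pi.single 0 1 : Fin 2 → K) f =
      algebraMap (MvPolynomial (Fin 2 × Fin r) M) _ (rename (fun l => ((0 : Fin 2), l)) f) := by
    rw [genericPoint, rename_eq_aeval, ← IsScalarTower.coe_toAlgHom' M, ← AlgHom.comp_apply]
    congr 1
    ext l : 1
    simp [Fin.sum_univ_two]
  rw [this]
  exact (map_ne_zero_iff _ (IsFractionRing.injective _ _)).2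
    ((map_ne_zero_iff _ (rename_injective _ (Prod.mk_right_injective _))).2 hf)

variable {F : MvPolynomial (Fin (N + 1)) K} {h : Fin (N + 1) → M} {j : Fin (N + 1)}
  {e : Fin (N + 1) → Fin r → M} {k : Fin r → Fin (N + 1)}

/-- The generic frame generates its field of definition. -/
theorem adjoin_genericFrame_eq_top (hh : IntermediateField.adjoin K (Set.range h) = ⊤)
    (hk : ∀ l, e (k l) = Pi.single l 1)
    (hF : ∀ p, aeval (fun i => linForm (e i)) p = 0 ↔ F ∣ p)
    (hgrad : ∀ i, aeval (fun i => linForm (e i)) (pderiv i F) =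
      C (h i) * aeval (fun i => linForm (e i)) (pderiv j F)) (hjF : ¬ F ∣ pderiv j F) :
    IntermediateField.adjoin K (Set.range fun i => genericFrame (K := K) e (X i)) = ⊤ := by
  let B := MvPolynomial (Fin 2 × Fin r) M
  let L := FractionRing B
  set E := IntermediateField.adjoin K (Set.range fun i => genericFrame (K := K) e (X i)) with hE
  have hmem : ∀ p, genericFrame (K := K) e p ∈ E := fun p => by
    induction p using MvPolynomial.induction_on with
    | C a => rw [← algebraMap_eq, AlgHom.commutes]; exact E.algebraMap_mem a
    | add p q hp hq => rw [map_add]; exact add_mem hp hq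
    | mul_X p i hp =>
      rw [map_mul]; exact mul_mem hp (IntermediateField.subset_adjoin _ _ ⟨i, rfl⟩)
  have hX : ∀ i, algebraMap B L (X i) ∈ E := fun i => by
    have : genericFrame (K := K) e (X (i.1, k i.2)) = algebraMap B L (X i) := by
      rw [genericFrame, aeval_X, hk, Finset.sum_eq_single_of_mem i.2 (Finset.mem_univ _)
        fun l _ hl => by rw [Pi.single_eq_of_ne hl, map_zero, zero_mul], Pi.single_eq_same, map_one,
        one_mul]
    rw [← this]
    exact hmem _
  have hM : ∀ z, algebraMap M L z ∈ E := algebraMap_mem_of_adjoin_eq_top hh fun i => by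
    have hf := genericPoint_single_ne_zero (K := K) fun h0 => hjF ((hF _).1 h0)
    have hi := hmem (atParam N (Pi.single 0 1) (pderiv i F))
    have hj := hmem (atParam N (Pi.single 0 1) (pderiv j F))
    rw [genericFrame_atParam] at hi hj
    have := div_mem hi hj
    rwa [hgrad, map_mul, mul_div_cancel_right₀ _ hf, ← algebraMap_eq, AlgHom.commutes] at this
  refine eq_top_of_algebraMap_mem (B := B) fun b => ?_
  induction b using MvPolynomial.induction_on with
  | C a =>
    have := hM a
    rwa [IsScalarTower.algebraMap_apply M B L] at this
  | add p q hp hq => rw [map_add]; exact add_mem hp hq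
  | mul_X p i hp => rw [map_mul]; exact mul_mem hp (hX i)

variable [IsAlgClosed K] {m δ : ℕ}

/-- The fibers of the Gauss map, being linear of dimension `r - 1` and parametrized by `m`
parameters, contain at most the lines of the hypersurface. -/
theorem add_two_mul_le_of_hasGrDim (hcov : CoveredByLines K F)
    (hdim : HasGrDim K (fanoSet K F) δ) (hm : Algebra.trdeg K M = m)
    (hh : IntermediateField.adjoin K (Set.range h) = ⊤) (hk : ∀ l, e (k l) = Pi.single l 1)
    (hF : ∀ p, aeval (fun i => linForm (e i)) p = 0 ↔ F ∣ p)
    (hgrad : ∀ i, aeval (fun i => linForm (e i)) (pderiv i F) =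
      C (h i) * aeval (fun i => linForm (e i)) (pderiv j F)) (hjF : ¬ F ∣ pderiv j F) :
    m + 2 * r ≤ δ + 2 * 2 ∧ ringKrullDim (MvPolynomial (Fin 2 × Fin (N + 1)) K ⧸
      RingHom.ker (genericFrame (K := K) e)) = ((m + 2 * r : ℕ) : WithBot ℕ∞) ∧
      Algebra.trdeg K (FractionRing (MvPolynomial (Fin 2 × Fin r) M)) = (m + 2 * r : ℕ) := by
  obtain ⟨d, hd, hd'⟩ := exists_ringKrullDim_quotient_ker_eq _
    (adjoin_genericFrame_eq_top hh hk hF hgrad hjF)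
  have hmd := hd'
  rw [trdeg_fractionField (M := M) (MvPolynomial (Fin 2 × Fin r) M), hm,
    MvPolynomial.trdeg_of_isDomain] at hmd
  obtain rfl : m + 2 * r = d := by
    simp only [Cardinal.mk_fintype, Fintype.card_prod, Fintype.card_fin, Cardinal.lift_natCast]
      at hmd
    exact_mod_cast hmd
  have hz : ∀ c, genericFrame e (atParam N c F) = 0 := fun c => by
    rw [genericFrame_atParam, (hF F).2 dvd_rfl, map_zero]
  have hprime : (RingHom.ker (genericFrame (K := K) e)).IsPrime := RingHom.ker_isPrime _
  have hle := ringKrullDim_quotient_le_of_fanoIdeal_le hcov hdim _ (fanoIdeal_le_ker _ hz)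
  rw [hd] at hle
  exact ⟨by exact_mod_cast hle, hd, hd'⟩

theorem le_of_fanoGenerallyReduced [CharZero K] (hcov : CoveredByLines K F)
    (hdim : HasGrDim K (fanoSet K F) δ) (hred : FanoGenerallyReduced K F)
    (hm : Algebra.trdeg K M = m)
    (hh : IntermediateField.adjoin K (Set.range h) = ⊤) (hk : ∀ l, e (k l) = Pi.single l 1)
    (hF : ∀ p, aeval (fun i => linForm (e i)) p = 0 ↔ F ∣ p)
    (hgrad : ∀ i, aeval (fun i => linForm (e i)) (pderiv i F) =
      C (h i) * aeval (fun i => linForm (e i)) (pderiv j F)) (hjF : ¬ F ∣ pderiv j F)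
    (heq : m + 2 * r = δ + 2 * 2) : 2 * N ≤ δ + 2 * 2 := by
  obtain ⟨-, hd, hd'⟩ := add_two_mul_le_of_hasGrDim hcov hdim hm hh hk hF hgrad hjF
  let L := FractionRing (MvPolynomial (Fin 2 × Fin r) M)
  let φ : MvPolynomial (Fin 2 × Fin (N + 1)) K →ₐ[K] L := genericFrame e
  have hz : ∀ c, φ (atParam N c F) = 0 := fun c => by
    rw [genericFrame_atParam, (hF F).2 dvd_rfl, map_zero]
  have hmin : RingHom.ker φ ∈ (fanoIdeal K F).minimalPrimes := by
    refine ⟨⟨RingHom.ker_isPrime _, fanoIdeal_le_ker φ hz⟩, fun P hP hPφ => ?_⟩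
    have := hP.1
    by_contra hnot
    obtain ⟨x, hx, hxP⟩ := Set.not_subset.1 hnot
    have h1 := ringKrullDim_succ_le_of_surjective (Ideal.Quotient.factor hPφ)
      (Ideal.Quotient.factor_surjective hPφ) (r := Ideal.Quotient.mk P x)
      (mem_nonZeroDivisors_of_ne_zero fun h0 => hxP (Ideal.Quotient.eq_zero_iff_mem.1 h0))
      (Ideal.Quotient.eq_zero_iff_mem.2 hx)
    have h2 := h1.trans (ringKrullDim_quotient_le_of_fanoIdeal_le hcov hdim P hP.2)
    rw [hd, ← heq] at h2
    have : m + 2 * r + 1 ≤ m + 2 * r := by exact_mod_cast h2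
    omega
  have hI : ∀ x, φ x = 0 → ∃ s, φ s ≠ 0 ∧ s * x ∈ fanoIdeal K F := fun x hx => hred _ hmin x hx
  have hV := finrank_le_of_trdeg_eq φ (adjoin_genericFrame_eq_top hh hk hF hgrad hjF) hI
    (orthogonalPairs fun i => algebraMap M L (h i)) (fun a ha g hg => by
      refine sum_mul_pderiv_eq_zero_of_mem_fanoIdeal φ hz (fun c => ?_) hg
      rw [mem_orthogonalPairs] at ha
      have hpar : ∀ p, φ (atParam N c p) =
          genericPoint M r c (aeval (fun i => linForm (e i)) p) := genericFrame_atParam e c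
      have hpt : ∀ i, φ (atParam N c (pderiv i F)) =
          algebraMap M L (h i) * φ (atParam N c (pderiv j F)) := fun i => by
        rw [hpar, hpar, hgrad, map_mul, ← algebraMap_eq, AlgHom.commutes]
      have : ∀ b, ∑ i, a (b, i) * (algebraMap K L (c b) * φ (atParam N c (pderiv i F))) =
          algebraMap K L (c b) * φ (atParam N c (pderiv j F)) *
            ∑ i, algebraMap M L (h i) * a (b, i) := fun b => by
        rw [Finset.mul_sum]
        refine Finset.sum_congr rfl fun i _ => ?_
        rw [hpt]
        ring
      rw [Fintype.sum_prod_type]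
      exact Finset.sum_eq_zero fun b _ => by rw [this, ha, mul_zero]) hd'
  have hV' := two_mul_card_le_finrank_orthogonalPairs fun i => algebraMap M L (h i)
  rw [Fintype.card_fin] at hV'
  omega

end genericFrame

/-- if `X ⊆ ℙ⁴` is an irreducible hypersurface covered by a two-dimensional
family of lines with generically reduced Fano scheme, then the dual variety of `X` is a
hypersurface of the dual `ℙ⁴`, i.e. it has dimension `3`. -/
theorem dual_variety_is_hypersurface
    (K : Type) [Field K] [IsAlgClosed K] [CharZero K]
    (n : ℕ) (F : MvPolynomial (Fin 5) K)
    (hdeg : F.IsHomogeneous n) (hIrr : Irreducible F)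
    (hcov : CoveredByLines K F) (hdim : HasGrDim K (fanoSet K F) 2)
    (hred : FanoGenerallyReduced K F) :
    HasProjDim K (projClosure K (dualVariety K F)) 3 := by
  obtain ⟨M, _, _, h, j, m, r, e, k, hj, hh, hm, hmr, hr, hk, hF, hgrad, hjF⟩ :=
    exists_gauss_fibration (N := 4) hdeg hIrr (by norm_num)
  have hle := (add_two_mul_le_of_hasGrDim hcov hdim hm hh hk hF hgrad hjF).1
  have hlt : m + 2 * r ≠ 2 + 2 * 2 := fun heq => by
    have := le_of_fanoGenerallyReduced hcov hdim hred hm hh hk hF hgrad hjF heq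
    omega
  obtain rfl : m = 3 := by omega
  exact hasProjDim_dualVariety hdeg hIrr hj hh hm hr hk hF hgrad hjF

end PaperLines
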